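/- Let k ≥ 2. There is a constant c > 0 such that for every function f : ℕ → ℕ with the property that every k-degenerate finite simple graph containing a path on n vertices contains an induced path on at least f(n) vertices, there are infinitely many integers n with f(n) ≤ c · log₂ log₂ n · log₂ log₂ log₂ n. -/

import Mathlib

def Degenerate {V : Type*} (k : ℕ) (G : SimpleGraph V) : Prop :=
  ∀ S : Set V, S.Finite → S.Nonempty → ∃ v ∈ S, {u ∈ S | G.Adj v u}.ncard ≤ k

/-- `G` contains a (not necessarily induced) path on `n` vertices. -/
def HasPathOn {V : Type*} (G : SimpleGraph V) (n : ℕ) : Prop :=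
  ∃ p : Fin n → V, Function.Injective p ∧
    ∀ (i : ℕ) (h : i + 1 < n), G.Adj (p ⟨i, Nat.lt_of_succ_lt h⟩) (p ⟨i + 1, h⟩)

/-- `G` contains an induced path on `n` vertices. -/
def HasInducedPathOn {V : Type*} (G : SimpleGraph V) (n : ℕ) : Prop :=
  ∃ p : Fin n → V, Function.Injective p ∧
    ∀ i j : Fin n, G.Adj (p i) (p j) ↔ (i.val + 1 = j.val ∨ j.val + 1 = i.val)

/-- `G` contains the complete bipartite graph `K_{t,t}` as a (not necessarily induced)
subgraph. -/
def ContainsKtt {V : Type*} (G : SimpleGraph V) (t : ℕ) : Prop :=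
  ∃ a b : Fin t → V, Function.Injective a ∧ Function.Injective b ∧
    (∀ i j, a i ≠ b j) ∧ (∀ i j, G.Adj (a i) (b j))

/-- Vertices of the tree-like graph: a word together with `some b` (a connecting vertex) or `none`
(the middle vertex of the gadget sitting at that word). -/
abbrev GVert := List Bool × Option Bool

/-- The suffix of length `n` of a list. -/
def suf (n : ℕ) (l : List Bool) : List Bool := l.drop (l.length - n)

/-- `u` is the end with label `σ` of the place `w`. -/
def IsEnd (σ : Bool) : List Bool → GVert → Prop
  | [], _ => False
  | b :: t, u => u = (t, if σ then none else some b)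

/-- `u` is an upper neighbour of `v`; `a d` is the hub attached to the gadgets of depth `d`. -/
def Up (a : ℕ → ℕ × Bool) (v u : GVert) : Prop :=
  (v.2 = none ∧ u.1 = v.1 ∧ u.2 ≠ none) ∨
    ∃ c, v.2 = some c ∧
      (IsEnd c v.1 u ∨ IsEnd (a v.1.length).2 (suf (a v.1.length).1 v.1) u)

/-- An induced path, indexed by the integers of `[x, y)`. -/
def IP (a : ℕ → ℕ × Bool) (Q : ℤ → GVert) (x y : ℤ) : Prop :=
  ∀ i j, x ≤ i → i < y → x ≤ j → j < y →
    (Q i = Q j → i = j) ∧ ((Up a (Q i) (Q j) ∨ Up a (Q j) (Q i)) ↔ (i + 1 = j ∨ j + 1 = i))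

/-- `v` lies below the place `w` and has depth smaller than `e`. -/
def Below (w : List Bool) (e : ℕ) (v : GVert) : Prop := w <:+ v.1 ∧ v.1.length < e

theorem length_suf {n : ℕ} {l : List Bool} (h : n ≤ l.length) : (suf n l).length = n := by
  simp [suf]; omega

theorem suf_suffix (n : ℕ) (l : List Bool) : suf n l <:+ l := List.drop_suffix _ _

theorem suf_eq_of_suffix {w l : List Bool} (h : w <:+ l) : suf w.length l = w :=
  (List.suffix_iff_eq_drop.1 h).symm

theorem suffix_of_suffix_suffix {u v l : List Bool} (hu : u <:+ l) (hv : v <:+ l)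
    (h : u.length ≤ v.length) : u <:+ v := List.suffix_of_suffix_length_le hu hv h

theorem IsEnd.length {σ : Bool} {w : List Bool} {u : GVert} (h : IsEnd σ w u) :
    u.1.length + 1 = w.length := by
  cases w with
  | nil => exact h.elim
  | cons b t => simp only [IsEnd] at h; simp [h]

theorem IsEnd.suffix {σ : Bool} {w : List Bool} {u : GVert} (h : IsEnd σ w u) : u.1 <:+ w := by
  cases w with
  | nil => exact h.elim
  | cons b t => simp only [IsEnd] at h; simp [h]

theorem IsEnd.unique {σ : Bool} {w : List Bool} {u v : GVert} (h : IsEnd σ w u)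
    (h' : IsEnd σ w v) : u = v := by
  cases w with
  | nil => exact h.elim
  | cons b t => simp only [IsEnd] at h h'; rw [h, h']

theorem IsEnd.label {σ τ : Bool} {w : List Bool} {u : GVert} (h : IsEnd σ w u)
    (h' : IsEnd τ w u) : σ = τ := by
  cases w with
  | nil => exact h.elim
  | cons b t =>
    simp only [IsEnd] at h h'
    rw [h] at h'
    cases σ <;> cases τ <;> simp_all

theorem IsEnd.adj {a : ℕ → ℕ × Bool} {σ τ : Bool} {w : List Bool} {u v : GVert}
    (h : IsEnd σ w u) (h' : IsEnd τ w v) (hne : σ ≠ τ) : Up a u v ∨ Up a v u := by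
  cases w with
  | nil => exact h.elim
  | cons b t =>
    simp only [IsEnd] at h h'
    subst h h'
    cases σ <;> cases τ <;> simp_all [Up]

theorem Up.suffix {a : ℕ → ℕ × Bool} {v u : GVert} (h : Up a v u) : u.1 <:+ v.1 := by
  rcases h with ⟨-, h, -⟩ | ⟨c, -, h | h⟩
  · rw [h]
  · exact h.suffix
  · exact h.suffix.trans (suf_suffix _ _)

theorem Up.length_le {a : ℕ → ℕ × Bool} {v u : GVert} (h : Up a v u) :
    u.1.length ≤ v.1.length := h.suffix.length_le

theorem IP.mono {a : ℕ → ℕ × Bool} {Q : ℤ → GVert} {x y x' y' : ℤ} (h : IP a Q x y)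
    (hx : x ≤ x') (hy : y' ≤ y) : IP a Q x' y' :=
  fun i j h1 h2 h3 h4 => h i j (hx.trans h1) (h2.trans_le hy) (hx.trans h3) (h4.trans_le hy)

theorem IP.shift {a : ℕ → ℕ × Bool} {Q : ℤ → GVert} {x y : ℤ} (h : IP a Q x y) (c : ℤ)
    {x' y' : ℤ} (hx : x' + c = x) (hy : y' + c = y) :
    IP a (fun t => Q (c + t)) x' y' := by
  intro i j h1 h2 h3 h4
  obtain ⟨h5, h6⟩ := h (c + i) (c + j) (by omega) (by omega) (by omega) (by omega)
  refine ⟨fun hh => ?_, h6.trans ?_⟩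
  · have := h5 hh; omega
  · omega

theorem IP.reflect {a : ℕ → ℕ × Bool} {Q : ℤ → GVert} {x y : ℤ} (h : IP a Q x y) (c : ℤ)
    {x' y' : ℤ} (hx : x' = c - y + 1) (hy : y' = c - x + 1) :
    IP a (fun t => Q (c - t)) x' y' := by
  intro i j h1 h2 h3 h4
  obtain ⟨h5, h6⟩ := h (c - i) (c - j) (by omega) (by omega) (by omega) (by omega)
  refine ⟨fun hh => ?_, h6.trans ?_⟩
  · have := h5 hh; omega
  · omega

theorem IP.adj {a : ℕ → ℕ × Bool} {Q : ℤ → GVert} {x y : ℤ} (h : IP a Q x y) {i : ℤ}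
    (h1 : x ≤ i) (h2 : i + 1 < y) : Up a (Q i) (Q (i + 1)) ∨ Up a (Q (i + 1)) (Q i) :=
  (h i (i + 1) h1 (by omega) (by omega) h2).2.2 (Or.inl rfl)

/-- A property of the vertices of a path that passes to neighbours holds everywhere once it holds
somewhere. -/
theorem IP.propagate {a : ℕ → ℕ × Bool} {Q : ℤ → GVert} {x y : ℤ} (h : IP a Q x y)
    (P : GVert → Prop)
    (hP : ∀ i j, x ≤ i → i < y → x ≤ j → j < y → P (Q i) →
      (Up a (Q i) (Q j) ∨ Up a (Q j) (Q i)) → P (Q j))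
    {i : ℤ} (h1 : x ≤ i) (h2 : i < y) (hi : P (Q i)) {j : ℤ} (h3 : x ≤ j) (h4 : j < y) :
    P (Q j) := by
  rcases le_total i j with hij | hij
  · induction j, hij using Int.leInduction with
    | base => exact hi
    | succ n hn ih =>
      exact hP n (n + 1) (by omega) (by omega) h3 h4 (ih (by omega) (by omega))
        (h.adj (by omega) h4)
  · induction j, hij using Int.leInductionDown with
    | base => exact hi
    | pred n hn ih =>
      refine hP n (n - 1) (by omega) (by omega) h3 h4 (ih (by omega) (by omega)) ?_
      have := h.adj h3 (by omega)
      rw [sub_add_cancel] at this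
      exact this.symm

/-- A path all of whose vertices have depth at least `d` stays below a single place of depth
`d`. -/
theorem IP.exists_place {a : ℕ → ℕ × Bool} {Q : ℤ → GVert} {x y : ℤ} (h : IP a Q x y)
    (hxy : x < y) {d e : ℕ} {w : List Bool} (hw : w.length ≤ d)
    (hb : ∀ i, x ≤ i → i < y → Below w e (Q i))
    (hd : ∀ i, x ≤ i → i < y → d ≤ (Q i).1.length) :
    ∃ w', w'.length = d ∧ w <:+ w' ∧ w' = suf d (Q x).1 ∧
      ∀ i, x ≤ i → i < y → Below w' e (Q i) := by
  have hl := length_suf (hd x le_rfl hxy)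
  refine ⟨suf d (Q x).1, hl,
    suffix_of_suffix_suffix (hb x le_rfl hxy).1 (suf_suffix _ _) (by omega), rfl,
    fun i h1 h2 => ?_⟩
  refine h.propagate (fun v => Below (suf d (Q x).1) e v) ?_ le_rfl hxy
    ⟨suf_suffix _ _, (hb x le_rfl hxy).2⟩ h1 h2
  rintro i j h1 h2 h3 h4 ⟨h5, -⟩ h6
  refine ⟨?_, (hb j h3 h4).2⟩
  rcases h6 with h6 | h6
  · exact suffix_of_suffix_suffix h5 h6.suffix (by rw [hl]; exact hd j h3 h4)
  · exact h5.trans h6.suffix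

theorem isEnd_of_crossing {a : ℕ → ℕ × Bool} (ha : ∀ d, (a d).1 ≤ d) {w w' : List Bool}
    {d e : ℕ} (hhub : ∀ i, d ≤ i → i < e → (a i).1 ≤ w.length ∨ d ≤ (a i).1) {u v : GVert}
    (hu : Below w e u) (hud : u.1.length < d) (hv : Below w' e v) (hw' : w'.length = d)
    (huv : Up a u v ∨ Up a v u) : ∃ σ, IsEnd σ w' u := by
  have hvd : d ≤ v.1.length := hw' ▸ hv.1.length_le
  rcases huv with huv | huv
  · have := huv.length_le; omega
  rcases huv with ⟨-, h, -⟩ | ⟨c, -, h | h⟩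
  · rw [h] at hud; omega
  · have := h.length
    have hw : w' = v.1 := hv.1.eq_of_length (by omega)
    exact ⟨c, hw ▸ h⟩
  · have h1 := h.length
    rw [length_suf (ha _)] at h1
    have h2 := hu.1.length_le
    have h3 : (a v.1.length).1 = w'.length := by
      rcases hhub _ hvd hv.2 with h4 | h4 <;> omega
    rw [h3, suf_eq_of_suffix hv.1] at h
    exact ⟨_, h⟩

/-- How a path below `w` is cut at depth `d`: its vertices of depth smaller than `d` form a segment,
attached to the remaining parts through ends of places of depth `d`. -/
theorem IP.split {a : ℕ → ℕ × Bool} (ha : ∀ d, (a d).1 ≤ d) {Q : ℤ → GVert} {x y : ℤ}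
    (h : IP a Q x y) (hxy : x < y) {w : List Bool} {d e : ℕ} (hwd : w.length ≤ d)
    (hhub : ∀ i, d ≤ i → i < e → (a i).1 ≤ w.length ∨ d ≤ (a i).1)
    (hb : ∀ i, x ≤ i → i < y → Below w e (Q i)) :
    (∃ w', w'.length = d ∧ w <:+ w' ∧ ∀ i, x ≤ i → i < y → Below w' e (Q i)) ∨
    ∃ i₀ j₀, x ≤ i₀ ∧ i₀ ≤ j₀ ∧ j₀ < y ∧ (∀ i, i₀ ≤ i → i ≤ j₀ → Below w d (Q i)) ∧
      (x < i₀ → ∃ w' σ, w'.length = d ∧ w <:+ w' ∧ IsEnd σ w' (Q i₀) ∧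
        ∀ i, x ≤ i → i < i₀ → Below w' e (Q i)) ∧
      (j₀ + 1 < y → ∃ w' σ, w'.length = d ∧ w <:+ w' ∧ IsEnd σ w' (Q j₀) ∧
        ∀ i, j₀ < i → i < y → Below w' e (Q i)) := by
  by_cases hlow : ∃ i, x ≤ i ∧ i < y ∧ (Q i).1.length < d
  swap
  · left
    push Not at hlow
    obtain ⟨w', h1, h2, -, h3⟩ := h.exists_place hxy hwd hb hlow
    exact ⟨w', h1, h2, h3⟩
  right
  -- no excursion between two shallow vertices
  have hrun : ∀ i j, x ≤ i → i < j → j < y → (Q i).1.length < d → (Q j).1.length < d →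
      (∀ l, i < l → l < j → d ≤ (Q l).1.length) → j = i + 1 := by
    intro i j h1 h2 h3 h4 h5 h6
    by_contra hne
    obtain ⟨w', h7, h8, -, h9⟩ := (h.mono (x' := i + 1) (y' := j) (by omega) (by omega)).exists_place
      (by omega) hwd (fun l h7 h8 => hb l (by omega) (by omega))
      (fun l h7 h8 => h6 l (by omega) (by omega))
    obtain ⟨σ, hσ⟩ := isEnd_of_crossing ha hhub (hb i h1 (by omega)) h4
      (h9 (i + 1) le_rfl (by omega)) h7 (h.adj h1 (by omega))
    have hadj := h.adj (i := j - 1) (by omega) (by omega)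
    rw [sub_add_cancel] at hadj
    obtain ⟨τ, hτ⟩ := isEnd_of_crossing ha hhub (hb j (by omega) h3) h5
      (h9 (j - 1) (by omega) (by omega)) h7 hadj.symm
    by_cases hστ : σ = τ
    · subst hστ
      have := (h i j h1 (by omega) (by omega) h3).1 (hσ.unique hτ)
      omega
    · have := (h i j h1 (by omega) (by omega) h3).2.1 (hσ.adj hτ hστ)
      omega
  have hconv : ∀ n : ℕ, ∀ i j, x ≤ i → i ≤ j → j < y → j - i ≤ n → (Q i).1.length < d →
      (Q j).1.length < d → ∀ l, i ≤ l → l ≤ j → (Q l).1.length < d := by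
    intro n
    induction n with
    | zero =>
      intro i j h1 h2 h3 h4 h5 h6 l h7 h8
      have : l = i := by push_cast at h4; omega
      exact this ▸ h5
    | succ n ih =>
      intro i j h1 h2 h3 h4 h5 h6 l h7 h8
      rcases h7.eq_or_lt with rfl | h7
      · exact h5
      obtain ⟨m, ⟨hm1, hm2, hm3⟩, hm4⟩ := Int.exists_least_of_bdd
        (P := fun m => i < m ∧ m ≤ j ∧ (Q m).1.length < d) ⟨i, fun z hz => hz.1.le⟩
        ⟨j, by omega, le_rfl, h6⟩
      have := hrun i m h1 hm1 (by omega) h5 hm3 (fun l h9 h10 => by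
        by_contra hc
        have := hm4 l ⟨h9, by omega, by omega⟩
        omega)
      subst this
      exact ih (i + 1) j (by omega) hm2 h3 (by push_cast at h4; omega) hm3 h6 l (by omega) h8
  obtain ⟨i₀, ⟨h1, h2, h3⟩, hmin⟩ := Int.exists_least_of_bdd
    (P := fun i => x ≤ i ∧ i < y ∧ (Q i).1.length < d) ⟨x, fun z hz => hz.1⟩ hlow
  obtain ⟨j₀, ⟨h4, h5, h6⟩, hmax⟩ := Int.exists_greatest_of_bdd
    (P := fun i => x ≤ i ∧ i < y ∧ (Q i).1.length < d) ⟨y, fun z hz => hz.2.1.le⟩ hlow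
  have hij : i₀ ≤ j₀ := hmax _ ⟨h1, h2, h3⟩
  refine ⟨i₀, j₀, h1, hij, h5, fun i h7 h8 => ⟨(hb i (by omega) (by omega)).1,
    hconv (j₀ - i₀).toNat i₀ j₀ h1 hij h5 (by omega) h3 h6 i h7 h8⟩, fun hx => ?_, fun hy => ?_⟩
  · obtain ⟨w', h7, h8, -, h9⟩ := (h.mono (x' := x) (y' := i₀) le_rfl (by omega)).exists_place
      hx hwd (fun l h7 h8 => hb l (by omega) (by omega))
      (fun l h7 h8 => by
        by_contra hc
        have := hmin l ⟨h7, by omega, by omega⟩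
        omega)
    have hadj := h.adj (i := i₀ - 1) (by omega) (by omega)
    rw [sub_add_cancel] at hadj
    obtain ⟨σ, hσ⟩ := isEnd_of_crossing ha hhub (hb i₀ h1 h2) h3
      (h9 (i₀ - 1) (by omega) (by omega)) h7 hadj.symm
    exact ⟨w', σ, h7, h8, hσ, h9⟩
  · obtain ⟨w', h7, h8, -, h9⟩ := (h.mono (x' := j₀ + 1) (y' := y) (by omega) le_rfl).exists_place
      hy hwd (fun l h7 h8 => hb l (by omega) (by omega))
      (fun l h7 h8 => by
        by_contra hc
        have := hmax l ⟨by omega, by omega, by omega⟩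
        omega)
    obtain ⟨σ, hσ⟩ := isEnd_of_crossing ha hhub (hb j₀ h4 h5) h6
      (h9 (j₀ + 1) (by omega) (by omega)) h7 (h.adj h4 hy)
    exact ⟨w', σ, h7, h8, hσ, fun i h10 h11 => h9 i (by omega) h11⟩

/-- An induced path starting at an end of the place `w` whose `n` other vertices lie below `w` and
have depth smaller than `e`. -/
structure Tail (a : ℕ → ℕ × Bool) (σ : Bool) (w : List Bool) (e : ℕ) (Q : ℤ → GVert) (n : ℤ) :
    Prop where
  isEnd : IsEnd σ w (Q 0)
  ip : IP a Q 0 (n + 1)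
  below : ∀ i, 1 ≤ i → i ≤ n → Below w e (Q i)

theorem IP.cut {a : ℕ → ℕ × Bool} (ha : ∀ d, (a d).1 ≤ d) {Q : ℤ → GVert} {x y : ℤ}
    (h : IP a Q x y) (hxy : x < y) {w : List Bool} {d e : ℕ} (hwd : w.length ≤ d)
    (hhub : ∀ i, d ≤ i → i < e → (a i).1 ≤ w.length ∨ d ≤ (a i).1)
    (hb : ∀ i, x ≤ i → i < y → Below w e (Q i)) :
    (∃ w', w'.length = d ∧ w <:+ w' ∧ ∀ i, x ≤ i → i < y → Below w' e (Q i)) ∨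
    ∃ i₀ j₀, x ≤ i₀ ∧ i₀ ≤ j₀ ∧ j₀ < y ∧ (∀ i, i₀ ≤ i → i < j₀ + 1 → Below w d (Q i)) ∧
      (x = i₀ ∨ x < i₀ ∧ (Q i₀).1.length + 1 = d ∧ ∃ w' σ, w'.length = d ∧ w <:+ w' ∧
        Tail a σ w' e (fun t => Q (i₀ - t)) (i₀ - x)) ∧
      (j₀ + 1 = y ∨ j₀ + 1 < y ∧ (Q j₀).1.length + 1 = d ∧ ∃ w' σ, w'.length = d ∧ w <:+ w' ∧
        Tail a σ w' e (fun t => Q (j₀ + t)) (y - 1 - j₀)) := by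
  rcases h.split ha hxy hwd hhub hb with h1 | ⟨i₀, j₀, h1, h2, h3, h4, h5, h6⟩
  · exact Or.inl h1
  right
  refine ⟨i₀, j₀, h1, h2, h3, fun i h7 h8 => h4 i h7 (by omega), ?_, ?_⟩
  · rcases h1.eq_or_lt with h1 | h1
    · exact Or.inl h1
    obtain ⟨w', σ, h7, h8, h9, h10⟩ := h5 h1
    refine Or.inr ⟨h1, h7 ▸ h9.length, w', σ, h7, h8, by simpa using h9, ?_,
      fun i hi hi' => h10 _ (by omega) (by omega)⟩
    exact (h.mono (x' := x) (y' := i₀ + 1) le_rfl (by omega)).reflect i₀ (by omega) (by omega)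
  · rcases (show j₀ + 1 ≤ y by omega).eq_or_lt with h1 | h1
    · exact Or.inl h1
    obtain ⟨w', σ, h7, h8, h9, h10⟩ := h6 h1
    refine Or.inr ⟨h1, h7 ▸ h9.length, w', σ, h7, h8, by simpa using h9, ?_,
      fun i hi hi' => h10 _ (by omega) (by omega)⟩
    exact (h.mono (x' := j₀) (y' := y) (by omega) le_rfl).shift j₀ (by omega) (by omega)

theorem IP.le_three {a : ℕ → ℕ × Bool} {Q : ℤ → GVert} {x y : ℤ} (h : IP a Q x y)
    {w : List Bool} (hb : ∀ i, x ≤ i → i < y → Below w (w.length + 1) (Q i)) : y - x ≤ 3 := by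
  by_contra hc
  have key : ∀ i, x ≤ i → i < y → (Q i).1 = w := fun i h1 h2 =>
    ((hb i h1 h2).1.eq_of_length_le (by have := (hb i h1 h2).2; omega)).symm
  have hinj : Function.Injective (fun i : Fin 4 => (Q (x + (i : ℕ))).2) := by
    intro i j hij
    have h1 := (h (x + (i : ℕ)) (x + (j : ℕ)) (by omega) (by omega) (by omega) (by omega)).1
      (Prod.ext ((key _ (by omega) (by omega)).trans (key _ (by omega) (by omega)).symm) hij)
    exact Fin.ext (by omega)
  simpa using Fintype.card_le_of_injective _ hinj

theorem Tail.length_ge {a : ℕ → ℕ × Bool} (ha : ∀ d, (a d).1 ≤ d) {σ : Bool} {w : List Bool}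
    {e : ℕ} {Q : ℤ → GVert} {n : ℤ} (h : Tail a σ w e Q n) (hn : 1 ≤ n) :
    (Q 1).2 ≠ none ∧ ((Q 1).1 = w ∧ (Q 1).2 = some σ ∨ a (Q 1).1.length = (w.length, σ)) := by
  have h1 := h.isEnd.length
  have h2 := h.below 1 le_rfl hn
  have h3 := h2.1.length_le
  rcases h.ip.adj le_rfl (by omega) with h4 | h4
  · have := h4.length_le
    simp only [zero_add] at this
    omega
  rw [zero_add] at h4
  rcases h4 with ⟨-, h, -⟩ | ⟨c, hc, h4 | h4⟩
  · rw [h] at h1; omega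
  · have h5 := h4.length
    have h6 := h2.1.eq_of_length (by omega)
    rw [← h6] at h4
    exact ⟨by simp [hc], Or.inl ⟨h6.symm, by rw [hc, h4.label h.isEnd]⟩⟩
  · have h5 := h4.length
    rw [length_suf (ha _)] at h5
    have h6 : (a (Q 1).1.length).1 = w.length := by omega
    rw [h6, suf_eq_of_suffix h2.1] at h4
    exact ⟨by simp [hc], Or.inr (Prod.ext h6 (h4.label h.isEnd))⟩

/-- Vertices attached to the first vertex of a tail through their hub occur only once. -/
theorem Tail.not_hub {a : ℕ → ℕ × Bool} {σ : Bool} {w : List Bool}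
    {e : ℕ} {Q : ℤ → GVert} {n : ℤ} (h : Tail a σ w e Q n) {i : ℤ} (h2 : 2 ≤ i) (hi : i ≤ n)
    (hne : (Q i).2 ≠ none) : a (Q i).1.length ≠ (w.length, σ) := by
  intro heq
  obtain ⟨c, hc⟩ := Option.ne_none_iff_exists'.1 hne
  have h1 : Up a (Q i) (Q 0) := by
    refine Or.inr ⟨c, hc, Or.inr ?_⟩
    rw [heq, suf_eq_of_suffix (h.below i (by omega) hi).1]
    exact h.isEnd
  have := (h.ip i 0 (by omega) (by omega) le_rfl (by omega)).2.1 (Or.inl h1)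
  omega

theorem Tail.le_of_hub_lt {a : ℕ → ℕ × Bool} (ha : ∀ d, (a d).1 ≤ d) {σ : Bool} {w : List Bool}
    {e : ℕ} {Q : ℤ → GVert} {n : ℤ} (h : Tail a σ w e Q n)
    (hhub : ∀ d, w.length ≤ d → d < e → (a d).1 < w.length) : n ≤ 3 * (e - w.length : ℕ) := by
  induction hm : e - w.length generalizing w σ Q n with
  | zero =>
    by_contra hc
    have h1 := h.below 1 le_rfl (by omega)
    have := h1.1.length_le
    have := h1.2
    omega
  | succ m ih =>
    rcases le_or_gt n 0 with hn | hn
    · omega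
    obtain ⟨-, h1⟩ := h.length_ge ha hn
    have hQ : (Q 1).1 = w := by
      rcases h1 with h1 | h1
      · exact h1.1
      · have := hhub (Q 1).1.length (h.below 1 le_rfl hn).1.length_le (h.below 1 le_rfl hn).2
        rw [h1] at this
        exact absurd this (lt_irrefl _)
    rcases (h.ip.mono (x' := 1) (y' := n + 1) (by omega) le_rfl).cut ha (by omega)
      (d := w.length + 1) (e := e) (Nat.le_succ _)
      (fun i h2 h3 => Or.inl (hhub i (by omega) h3).le)
      (fun i h2 h3 => h.below i h2 (by omega)) with ⟨w', h2, h3, h4⟩ | ⟨i₀, j₀, h2, h3, h4, h5, h6, h7⟩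
    · have := (h4 1 le_rfl (by omega)).1.length_le
      rw [hQ] at this
      omega
    have h8 : i₀ = 1 := by
      rcases h6 with h6 | ⟨h6, -, w', τ, h8, h9, h10⟩
      · exact h6.symm
      have := (h10.below (i₀ - 1) (by omega) (by omega)).1.length_le
      simp only [sub_sub_cancel, hQ] at this
      omega
    have h9 := (h.ip.mono (x' := i₀) (y' := j₀ + 1) (by omega) (by omega)).le_three h5
    rcases h7 with h7 | ⟨h7, -, w', τ, h10, h11, h12⟩
    · omega
    have h13 := ih h12 (fun d h13 h14 => by have := hhub d (by omega) h14; omega)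
      (by clear h6; omega)
    clear h6
    push_cast at h13 ⊢
    omega

theorem IP.le_of_hub_le {a : ℕ → ℕ × Bool} (ha : ∀ d, (a d).1 ≤ d) {w : List Bool}
    {e : ℕ} {Q : ℤ → GVert} {x y : ℤ} (h : IP a Q x y)
    (hb : ∀ i, x ≤ i → i < y → Below w e (Q i))
    (hhub : ∀ d, w.length ≤ d → d < e → (a d).1 ≤ w.length) : y - x ≤ 6 * (e - w.length : ℕ) := by
  induction hm : e - w.length generalizing w Q x y with
  | zero =>
    by_contra hc
    have h1 := hb x le_rfl (by omega)
    have := h1.1.length_le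
    have := h1.2
    omega
  | succ m ih =>
    rcases le_or_gt y x with hn | hn
    · omega
    rcases h.cut ha hn (d := w.length + 1) (e := e) (Nat.le_succ _)
      (fun i h2 h3 => Or.inl (hhub i (by omega) h3)) hb
      with ⟨w', h2, h3, h4⟩ | ⟨i₀, j₀, h2, h3, h4, h5, h6, h7⟩
    · have := ih h h4 (fun d h13 h14 => by have := hhub d (by omega) h14; omega) (by omega)
      push_cast
      omega
    have h9 := (h.mono (x' := i₀) (y' := j₀ + 1) (by omega) (by omega)).le_three h5
    have key : ∀ {τ w' Q' n}, w'.length = w.length + 1 → Tail a τ w' e Q' n → n ≤ 3 * (m : ℕ) := by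
      intro τ w' Q' n h10 h12
      have := h12.le_of_hub_lt ha (fun d h13 h14 => by have := hhub d (by omega) h14; omega)
      have h11 : e - w'.length = m := by clear h6 h7; omega
      rwa [h11] at this
    have h10 : i₀ - x ≤ 3 * (m : ℕ) := by
      rcases h6 with h6 | ⟨h6, -, w', τ, h10, h11, h12⟩
      · omega
      · exact key h10 h12
    have h11 : y - 1 - j₀ ≤ 3 * (m : ℕ) := by
      rcases h7 with h6 | ⟨h6, -, w', τ, h10, h11, h12⟩
      · omega
      · exact key h10 h12
    push_cast
    omega

/-- The layer between the connecting vertices of depth `lo` and those of depth `hi`. -/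
def Region (lo hi : ℕ) (v : GVert) : Prop :=
  v.1.length = lo ∧ v.2 = none ∨ lo < v.1.length ∧ v.1.length < hi

theorem IP.region {a : ℕ → ℕ × Bool} (ha : ∀ d, (a d).1 ≤ d) {w : List Bool}
    {e lo hi : ℕ} {Q : ℤ → GVert} {x y : ℤ} (h : IP a Q x y)
    (hb : ∀ i, x ≤ i → i < y → Below w e (Q i)) (hlo : w.length ≤ lo) (hlt : lo < hi)
    (hhub : ∀ d, lo < d → d < hi → (a d).1 ≤ w.length)
    (hno : ∀ d, w.length ≤ d → d < e → ¬ (lo < (a d).1 ∧ (a d).1 ≤ hi))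
    (hp : ∀ i, x ≤ i → i < y → (Q i).2 ≠ none → (Q i).1.length ≠ lo ∧ (Q i).1.length ≠ hi)
    {t : ℤ} (hx : x ≤ t) (hy : t < y) (ht : Region lo hi (Q t)) :
    (∀ i, x ≤ i → i < y → Region lo hi (Q i)) ∧ y - x ≤ 6 * (hi - lo : ℕ) := by
  have key : ∀ i, x ≤ i → i < y → Region lo hi (Q i) := by
    intro i h1 h2
    refine h.propagate (Region lo hi) ?_ hx hy ht h1 h2
    intro i j h1 h2 h3 h4 h5 h6
    have bi := hb i h1 h2
    have bj := hb j h3 h4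
    have bi' := bi.1.length_le
    have bj' := bj.1.length_le
    have pi := hp i h1 h2
    have pj := hp j h3 h4
    unfold Region at h5 ⊢
    rcases h6 with (⟨h6, h7, h8⟩ | ⟨c, hc, h6 | h6⟩) | (⟨h6, h7, h8⟩ | ⟨c, hc, h6 | h6⟩)
    · have := pj h8
      rw [h7] at this ⊢
      rcases h5 with h5 | h5 <;> omega
    · have := h6.length
      rcases h5 with h5 | h5
      · simp [hc] at h5
      by_cases h8 : (Q j).2 = none
      · simp only [h8, and_true]; omega
      · have := pj h8; omega
    · have := h6.length
      rw [length_suf (ha _)] at this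
      rcases h5 with h5 | h5
      · simp [hc] at h5
      have := hhub _ h5.1 h5.2
      omega
    · simp only [h6, and_true]
      rw [h7] at h5
      have := pi h8
      omega
    · have := h6.length
      have := pj (by simp [hc])
      omega
    · have := h6.length
      rw [length_suf (ha _)] at this
      have := hno _ bj' bj.2
      omega
  refine ⟨key, ?_⟩
  have hd : ∀ i, x ≤ i → i < y → lo ≤ (Q i).1.length := fun i h1 h2 => by
    rcases key i h1 h2 with h3 | h3 <;> omega
  obtain ⟨w', h1, h2, -, h3⟩ := h.exists_place (hx.trans_lt hy) hlo hb hd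
  have h4 := h.le_of_hub_le ha (w := w') (e := hi)
    (fun i h4 h5 => ⟨(h3 i h4 h5).1, by rcases key i h4 h5 with h3 | h3 <;> omega⟩)
    (fun d h4 h5 => by
      rcases h4.eq_or_lt with h4 | h4
      · rw [h4]; exact ha d
      · have := hhub d (by omega) h5
        omega)
  rwa [h1] at h4

/-- The number of depths taken by the seal of a block of rank `k`. -/
def sealLen (κ : ℕ → ℕ) (k : ℕ) : ℕ := 4 * (κ k - k + 1)

/-- The hub prescribed at a given offset of the seal of a block of rank `k`: the two sides of the
ancestor places of rank `k, …, κ k` in increasing and then in decreasing order. -/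
def sealHub (κ : ℕ → ℕ) (k : ℕ) (anc : ℕ → ℕ) (off : ℕ) : ℕ × Bool :=
  (anc (k + min off (sealLen κ k - 1 - off) / 2),
    decide (min off (sealLen κ k - 1 - off) % 2 = 1))

/-- The number of depths taken by a block of rank `k`. -/
def blockLen (κ : ℕ → ℕ) : ℕ → ℕ
  | 0 => sealLen κ 0
  | k + 1 => 2 * blockLen κ k + sealLen κ (k + 1)

/-- The number of depths taken by a block of rank `k` before its seal. -/
def coreLen (κ : ℕ → ℕ) : ℕ → ℕ
  | 0 => 0
  | k + 1 => 2 * blockLen κ k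

/-- The hubs at the depths from `s` on form a block of rank `k`; `anc r` is the depth of the place at
which the enclosing block of rank `r` starts. -/
def IsBlock (a : ℕ → ℕ × Bool) (κ : ℕ → ℕ) : ℕ → (ℕ → ℕ) → ℕ → Prop
  | 0, anc, s => ∀ off < sealLen κ 0, a (s + off) = sealHub κ 0 (Function.update anc 0 s) off
  | k + 1, anc, s => IsBlock a κ k (Function.update anc (k + 1) s) s ∧
      IsBlock a κ k (Function.update anc (k + 1) s) (s + blockLen κ k) ∧
      ∀ off < sealLen κ (k + 1),
        a (s + 2 * blockLen κ k + off) = sealHub κ (k + 1) (Function.update anc (k + 1) s) off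

/-- A block together with the standing assumptions on the hubs and ranks. -/
structure Block (a : ℕ → ℕ × Bool) (κ : ℕ → ℕ) (L i : ℕ) (anc : ℕ → ℕ) (s : ℕ) : Prop where
  hub_le : ∀ d, (a d).1 ≤ d
  rank_le : ∀ k ≤ L, k ≤ κ k ∧ κ k ≤ L
  le : i ≤ L
  anc_le : ∀ r, i < r → r ≤ L → anc r ≤ s
  isBlock : IsBlock a κ i anc s

section

variable {a : ℕ → ℕ × Bool} {κ : ℕ → ℕ} {L i s : ℕ} {anc : ℕ → ℕ}

theorem blockLen_eq (k : ℕ) : blockLen κ k = coreLen κ k + sealLen κ k := by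
  cases k <;> simp [blockLen, coreLen]

theorem four_le_sealLen (k : ℕ) : 4 ≤ sealLen κ k := by unfold sealLen; omega

theorem sealHub_slot {k r : ℕ} (h1 : k ≤ r) (h2 : r ≤ κ k) (σ : Bool) :
    sealHub κ k anc (2 * (r - k) + σ.toNat) = (anc r, σ) := by
  have h3 : min (2 * (r - k) + σ.toNat) (sealLen κ k - 1 - (2 * (r - k) + σ.toNat)) =
      2 * (r - k) + σ.toNat := by
    unfold sealLen
    have := σ.toNat_le
    omega
  rw [sealHub, h3]
  have h4 : k + (2 * (r - k) + σ.toNat) / 2 = r := by have := σ.toNat_le; omega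
  rw [h4]
  cases σ <;> simp

theorem sealHub_mirror {k off : ℕ} (h : off < sealLen κ k) :
    sealHub κ k anc (sealLen κ k - 1 - off) = sealHub κ k anc off := by
  have h1 : min (sealLen κ k - 1 - off) (sealLen κ k - 1 - (sealLen κ k - 1 - off)) =
      min off (sealLen κ k - 1 - off) := by omega
  rw [sealHub, h1, sealHub]

theorem sealHub_rank {k off : ℕ} (h : off < sealLen κ k) :
    k + min off (sealLen κ k - 1 - off) / 2 ≤ κ k ∨ κ k < k := by
  unfold sealLen at *
  omega

theorem Block.seal (h : Block a κ L i anc s) {off : ℕ} (ho : off < sealLen κ i) :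
    a (s + coreLen κ i + off) = sealHub κ i (Function.update anc i s) off := by
  have := h.isBlock
  cases i with
  | zero => exact this off ho
  | succ i => exact this.2.2 off ho

theorem Block.update_le (h : Block a κ L i anc s) {r : ℕ} (h1 : i ≤ r) (h2 : r ≤ L) :
    Function.update anc i s r ≤ s := by
  rcases h1.eq_or_lt with rfl | h1
  · simp
  · rw [Function.update_of_ne (by omega)]
    exact h.anc_le r h1 h2

theorem Block.sealHub_le (h : Block a κ L i anc s) {off : ℕ} (ho : off < sealLen κ i) :
    (sealHub κ i (Function.update anc i s) off).1 ≤ s := by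
  have := h.rank_le i h.le
  rcases sealHub_rank ho with h1 | h1
  · exact h.update_le (by omega) (by omega)
  · omega

theorem Block.seal_le (h : Block a κ L i anc s) {d : ℕ} (h1 : s + coreLen κ i ≤ d)
    (h2 : d < s + blockLen κ i) : (a d).1 ≤ s := by
  obtain ⟨off, rfl⟩ := Nat.exists_eq_add_of_le h1
  have h3 : off < sealLen κ i := by rw [blockLen_eq] at h2; omega
  rw [h.seal h3]
  exact h.sealHub_le h3

theorem Block.left (h : Block a κ L (i + 1) anc s) :
    Block a κ L i (Function.update anc (i + 1) s) s where
  hub_le := h.hub_le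
  rank_le := h.rank_le
  le := by have := h.le; omega
  anc_le r h1 h2 := h.update_le h1 h2
  isBlock := h.isBlock.1

theorem Block.right (h : Block a κ L (i + 1) anc s) :
    Block a κ L i (Function.update anc (i + 1) s) (s + blockLen κ i) where
  hub_le := h.hub_le
  rank_le := h.rank_le
  le := by have := h.le; omega
  anc_le r h1 h2 := (h.update_le h1 h2).trans (by omega)
  isBlock := h.isBlock.2.1

theorem Block.lt_right (h : Block a κ L (i + 1) anc s) {r : ℕ} (h1 : i < r) (h2 : r ≤ L) :
    Function.update anc (i + 1) s r < s + blockLen κ i := by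
  have := h.update_le h1 h2
  have := four_le_sealLen (κ := κ) i
  rw [blockLen_eq]
  omega

theorem Block.hub (h : Block a κ L i anc s) {t : ℕ} (h1 : s ≤ t) (h2 : t < s + blockLen κ i) :
    (∃ r, i < r ∧ r ≤ L ∧ (a t).1 = anc r) ∨ s ≤ (a t).1 := by
  induction i generalizing anc s with
  | zero =>
    obtain ⟨off, rfl⟩ := Nat.exists_eq_add_of_le h1
    have h3 : off < sealLen κ 0 := by simpa [blockLen] using h2
    have h4 := h.seal h3
    rw [coreLen, add_zero] at h4
    rw [h4, sealHub]
    have h5 := h.rank_le 0 h.le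
    have h6 := sealHub_rank h3
    simp only
    rcases Nat.eq_zero_or_pos (0 + min off (sealLen κ 0 - 1 - off) / 2) with h7 | h7
    · right
      rw [h7]
      simp
    · exact Or.inl ⟨_, h7, by omega, Function.update_of_ne (by omega) _ _⟩
  | succ i ih =>
    have hlen : blockLen κ (i + 1) = 2 * blockLen κ i + sealLen κ (i + 1) := rfl
    have key : ∀ s', s ≤ s' → ((∃ r, i < r ∧ r ≤ L ∧ (a t).1 = Function.update anc (i + 1) s r) ∨
        s' ≤ (a t).1) → (∃ r, i + 1 < r ∧ r ≤ L ∧ (a t).1 = anc r) ∨ s ≤ (a t).1 := by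
      rintro s' h3 (⟨r, h4, h5, h6⟩ | h4)
      · by_cases h7 : r = i + 1
        · subst h7
          right
          simp [h6]
        · left
          rw [Function.update_of_ne h7] at h6
          exact ⟨r, by omega, h5, h6⟩
      · exact Or.inr (h3.trans h4)
    by_cases h3 : t < s + blockLen κ i
    · exact key s le_rfl (ih h.left h1 h3)
    by_cases h4 : t < s + 2 * blockLen κ i
    · exact key (s + blockLen κ i) (by omega) (ih h.right (by omega) (by omega))
    obtain ⟨off, rfl⟩ := Nat.exists_eq_add_of_le (Nat.le_of_not_lt h4)
    have h5 : off < sealLen κ (i + 1) := by omega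
    have h6 := h.seal h5
    rw [coreLen] at h6
    have h7 := h.rank_le (i + 1) h.le
    have h8 := sealHub_rank h5
    refine key _ le_rfl (Or.inl ⟨_, ?_, ?_, by rw [h6, sealHub]⟩) <;> omega

theorem Block.hub_right (h : Block a κ L (i + 1) anc s) {t : ℕ} (h1 : s + blockLen κ i ≤ t)
    (h2 : t < s + 2 * blockLen κ i) : (a t).1 ≤ s ∨ s + blockLen κ i ≤ (a t).1 := by
  rcases h.right.hub h1 (by omega) with ⟨r, h3, h4, h5⟩ | h3
  · exact Or.inl (h5 ▸ h.update_le h3 h4)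
  · exact Or.inr h3

/-- The seal containing a given depth of a block. -/
theorem Block.locate (h : Block a κ L i anc s) {d : ℕ} (h1 : s ≤ d) (h2 : d < s + blockLen κ i) :
    ∃ k s' anc', k ≤ i ∧ s ≤ s' ∧ s' ≤ d ∧ d < s' + sealLen κ k ∧
      s' + sealLen κ k ≤ s + blockLen κ i ∧
      (∀ off < sealLen κ k, a (s' + off) = sealHub κ k anc' off) ∧
      (∀ r, i ≤ r → anc' r = Function.update anc i s r) ∧ (∀ r, k ≤ r → r ≤ i → s ≤ anc' r) ∧
      ∀ t, s ≤ t → t < s + blockLen κ i → ¬ (s' < (a t).1 ∧ (a t).1 < s' + sealLen κ k) := by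
  induction i generalizing anc s with
  | zero =>
    have h3 : blockLen κ 0 = sealLen κ 0 := rfl
    rw [h3] at h2
    refine ⟨0, s, Function.update anc 0 s, le_rfl, le_rfl, h1, h2, by rw [h3], fun off ho => h.seal ho,
      fun r _ => rfl, fun r h4 h5 => ?_, fun t h4 h5 h6 => ?_⟩
    · obtain rfl : r = 0 := by omega
      simp
    · have := h.seal_le (d := t) (by simpa [coreLen] using h4) h5
      omega
  | succ i ih =>
    have hlen : blockLen κ (i + 1) = 2 * blockLen κ i + sealLen κ (i + 1) := rfl
    have hseal : ∀ t, s + 2 * blockLen κ i ≤ t → t < s + blockLen κ (i + 1) → (a t).1 ≤ s :=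
      fun t h3 h4 => h.seal_le h3 h4
    have hhub := h.hub_le
    by_cases h3 : d < s + blockLen κ i
    · obtain ⟨k, s', anc', h4, h5, h6, h7, h8, h9, h10, h11, h12⟩ := ih h.left h1 h3
      refine ⟨k, s', anc', by omega, h5, h6, h7, by omega, h9, fun r hr => ?_, fun r g1 g2 => ?_,
        fun t g1 g2 => ?_⟩
      · rw [h10 r (by omega), Function.update_of_ne (by omega)]
      · rcases g2.eq_or_lt with rfl | g2
        · rw [h10 _ (by omega), Function.update_of_ne (by omega)]
          simp
        · exact h11 r g1 (by omega)
      · by_cases g3 : t < s + blockLen κ i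
        · exact h12 t g1 g3
        by_cases g4 : t < s + 2 * blockLen κ i
        · have := h.hub_right (t := t) (by omega) g4
          omega
        · have := hseal t (by omega) g2
          omega
    by_cases h3' : d < s + 2 * blockLen κ i
    · obtain ⟨k, s', anc', h4, h5, h6, h7, h8, h9, h10, h11, h12⟩ :=
        ih h.right (by omega) (by omega)
      refine ⟨k, s', anc', by omega, by omega, h6, h7, by omega, h9, fun r hr => ?_,
        fun r g1 g2 => ?_, fun t g1 g2 => ?_⟩
      · rw [h10 r (by omega), Function.update_of_ne (by omega)]
      · rcases g2.eq_or_lt with rfl | g2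
        · rw [h10 _ (by omega), Function.update_of_ne (by omega)]
          simp
        · exact (Nat.le_add_right _ _).trans (h11 r g1 (by omega))
      · by_cases g3 : t < s + blockLen κ i
        · have := hhub t
          omega
        by_cases g4 : t < s + 2 * blockLen κ i
        · exact h12 t (by omega) (by omega)
        · have := hseal t (by omega) g2
          omega
    · refine ⟨i + 1, s + 2 * blockLen κ i, Function.update anc (i + 1) s, le_rfl, by omega, by omega,
        by omega, by omega, fun off ho => h.seal ho, fun r _ => rfl, fun r g1 g2 => ?_,
        fun t g1 g2 => ?_⟩
      · obtain rfl : r = i + 1 := by omega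
        simp
      · by_cases g4 : t < s + 2 * blockLen κ i
        · have := hhub t
          omega
        · have := hseal t (by omega) g2
          omega

end

/-- `v` is a connecting vertex attached to the hub `X`. -/
def Mark (a : ℕ → ℕ × Bool) (X : ℕ × Bool) (v : GVert) : Prop :=
  v.2 ≠ none ∧ a v.1.length = X

/-- `j` is the largest rank (at most `L`) of an ancestor starting at depth `x`. -/
def IsRank (L j x : ℕ) (anc : ℕ → ℕ) : Prop :=
  (j ≤ L → anc j = x) ∧ ∀ r, j < r → r ≤ L → anc r ≠ x

/-- The bound for paths between two bottom vertices of a block of rank `i` that avoid the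
neighbourhood of a vertex of rank `j`. -/
def crossBound (κ : ℕ → ℕ) (j : ℕ) : ℕ → ℕ
  | 0 => if j ≤ κ 0 then 12 * j + 14 else 6 * sealLen κ 0 + 12 * j + 14
  | i + 1 => if j ≤ κ (i + 1) then 12 * (j - (i + 1)) + 14
      else crossBound κ j i + 12 * sealLen κ (i + 1) + 26

section

variable {a : ℕ → ℕ × Bool} {κ : ℕ → ℕ} {L i j s : ℕ} {anc : ℕ → ℕ} {X : ℕ × Bool}
  {w : List Bool} {Q : ℤ → GVert} {x y : ℤ}

theorem IsRank.update {x : ℕ} (h : IsRank L j x anc) (hij : i < j) (s : ℕ) :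
    IsRank L j x (Function.update anc i s) := by
  refine ⟨fun h1 => ?_, fun r h1 h2 => ?_⟩
  · rw [Function.update_of_ne (by omega)]
    exact h.1 h1
  · rw [Function.update_of_ne (by omega)]
    exact h.2 r h1 h2

theorem le_crossBound : 12 * (j - i) + 14 ≤ crossBound κ j i := by
  induction i with
  | zero => rw [crossBound]; split <;> omega
  | succ i ih => rw [crossBound]; split <;> omega

theorem crossBound_of_le (h : j ≤ κ i) : crossBound κ j i = 12 * (j - i) + 14 := by
  cases i <;> simp [crossBound, h]

theorem crossBound_succ (h : κ (i + 1) < j) :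
    crossBound κ j (i + 1) = crossBound κ j i + 12 * sealLen κ (i + 1) + 26 := by
  rw [crossBound, if_neg (by omega)]

theorem le_crossBound_zero (h : κ 0 < j) : 6 * sealLen κ 0 ≤ crossBound κ j 0 := by
  rw [crossBound, if_neg (by omega)]; omega

theorem Block.slot (h : Block a κ L i anc s) (hij : i ≤ j) (hj : j ≤ κ i) (σ : Bool) :
    a (s + coreLen κ i + (2 * (j - i) + σ.toNat)) = (Function.update anc i s j, σ) ∧
    a (s + coreLen κ i + (sealLen κ i - 1 - (2 * (j - i) + σ.toNat))) =
      (Function.update anc i s j, σ) := by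
  have h1 : 2 * (j - i) + σ.toNat < sealLen κ i := by
    have := σ.toNat_le
    unfold sealLen
    omega
  rw [h.seal h1, h.seal (by omega), sealHub_mirror h1, sealHub_slot hij hj]
  exact ⟨rfl, rfl⟩

theorem Block.region (h : Block a κ L i anc s) (hw : w.length = s) {lo : ℕ}
    (hlo : s + coreLen κ i ≤ lo) (hlo' : lo < s + blockLen κ i) (hQ : IP a Q x y)
    (hb : ∀ t, x ≤ t → t < y → Below w (s + blockLen κ i) (Q t))
    (hp : ∀ t, x ≤ t → t < y → (Q t).2 ≠ none → (Q t).1.length ≠ lo)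
    {t : ℤ} (hx : x ≤ t) (hy : t < y) (ht : Region lo (s + blockLen κ i) (Q t)) :
    (∀ t, x ≤ t → t < y → Region lo (s + blockLen κ i) (Q t)) ∧
      y - x ≤ 6 * (s + blockLen κ i - lo : ℕ) := by
  refine hQ.region h.hub_le hb (by omega) hlo' (fun d h1 h2 => ?_) (fun d h1 h2 h3 => ?_)
    (fun t h1 h2 h3 => ⟨hp t h1 h2 h3, ?_⟩) hx hy ht
  · rw [hw]
    exact h.seal_le (by omega) h2
  · rw [hw] at h1
    have := h.hub_le d
    by_cases h4 : s + coreLen κ i ≤ d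
    · have := h.seal_le h4 h2
      omega
    · omega
  · have := (hb t h1 h2).2
    omega

theorem Block.cut_seal (h : Block a κ L (i + 1) anc s) (hw : w.length = s) {u : ℕ}
    (hu : u ≤ s + blockLen κ (i + 1)) (hQ : IP a Q x y) (hxy : x < y)
    (hb : ∀ t, x ≤ t → t < y → Below w u (Q t)) :
    y - x ≤ 6 * (u - (s + 2 * blockLen κ i) : ℕ) ∨
    ∃ x' y', x ≤ x' ∧ x' < y' ∧ y' ≤ y ∧
      (∀ t, x' ≤ t → t < y' → Below w (s + 2 * blockLen κ i) (Q t)) ∧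
      (x = x' ∨ x < x' ∧ (Q x').1.length + 1 = s + 2 * blockLen κ i ∧
        x' - x ≤ 3 * (u - (s + 2 * blockLen κ i) : ℕ)) ∧
      (y' = y ∨ y' < y ∧ (Q (y' - 1)).1.length + 1 = s + 2 * blockLen κ i ∧
        y - y' ≤ 3 * (u - (s + 2 * blockLen κ i) : ℕ)) := by
  have hs : ∀ d, s + 2 * blockLen κ i ≤ d → d < u → (a d).1 ≤ s :=
    fun d h1 h2 => h.seal_le h1 (by omega)
  have hpos := four_le_sealLen (κ := κ) i
  have hlen := blockLen_eq (κ := κ) i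
  rcases hQ.cut h.hub_le hxy (w := w) (d := s + 2 * blockLen κ i) (e := u) (by omega)
    (fun d h1 h2 => Or.inl (hw ▸ hs d h1 h2)) hb with
    ⟨w', h1, h2, h3⟩ | ⟨i₀, j₀, h1, h2, h3, h4, h5, h6⟩
  · left
    rw [← h1]
    exact hQ.le_of_hub_le h.hub_le h3 (fun d h4 h5 => (hs d (by omega) h5).trans (by omega))
  right
  have key : ∀ {τ w' Q' n}, w'.length = s + 2 * blockLen κ i → Tail a τ w' u Q' n →
      n ≤ 3 * (u - (s + 2 * blockLen κ i) : ℕ) := by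
    intro τ w' Q' n h1 h2
    rw [← h1]
    exact h2.le_of_hub_lt h.hub_le (fun d h3 h4 => (hs d (by omega) h4).trans_lt (by omega))
  refine ⟨i₀, j₀ + 1, h1, by omega, by omega, h4, ?_, ?_⟩
  · rcases h5 with h5 | ⟨h5, h7, w', σ, h8, h9, h10⟩
    · exact Or.inl h5
    · exact Or.inr ⟨h5, h7, key h8 h10⟩
  · rcases h6 with h5 | ⟨h5, h7, w', σ, h8, h9, h10⟩
    · exact Or.inl h5
    · have := key h8 h10
      exact Or.inr ⟨h5, by simpa using h7, by omega⟩

theorem Block.cut_core (h : Block a κ L (i + 1) anc s) (hw : w.length = s)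
    (hQ : IP a Q x y) (hxy : x < y)
    (hb : ∀ t, x ≤ t → t < y → Below w (s + 2 * blockLen κ i) (Q t)) :
    (∃ w', w'.length = s + blockLen κ i ∧
      ∀ t, x ≤ t → t < y → Below w' (s + blockLen κ i + blockLen κ i) (Q t)) ∨
    ∃ x' y', x ≤ x' ∧ x' < y' ∧ y' ≤ y ∧
      (∀ t, x' ≤ t → t < y' → Below w (s + blockLen κ i) (Q t)) ∧
      (x = x' ∨ x < x' ∧ (Q x').1.length + 1 = s + blockLen κ i ∧
        ∃ w' σ, w'.length = s + blockLen κ i ∧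
          Tail a σ w' (s + blockLen κ i + blockLen κ i) (fun t => Q (x' - t)) (x' - x)) ∧
      (y' = y ∨ y' < y ∧ (Q (y' - 1)).1.length + 1 = s + blockLen κ i ∧
        ∃ w' σ, w'.length = s + blockLen κ i ∧
          Tail a σ w' (s + blockLen κ i + blockLen κ i) (fun t => Q (y' - 1 + t)) (y - y')) := by
  have he : s + 2 * blockLen κ i = s + blockLen κ i + blockLen κ i := by ring
  rw [he] at hb
  rcases hQ.cut h.hub_le hxy (w := w) (d := s + blockLen κ i)
    (e := s + blockLen κ i + blockLen κ i) (by omega)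
    (fun d h1 h2 => by have := h.hub_right h1 (by omega); rwa [hw]) hb with
    ⟨w', h1, h2, h3⟩ | ⟨i₀, j₀, h1, h2, h3, h4, h5, h6⟩
  · exact Or.inl ⟨w', h1, h3⟩
  right
  refine ⟨i₀, j₀ + 1, h1, by omega, by omega, h4, ?_, ?_⟩
  · rcases h5 with h5 | ⟨h5, h7, w', σ, h8, h9, h10⟩
    · exact Or.inl h5
    · exact Or.inr ⟨h5, h7, w', σ, h8, h10⟩
  · rcases h6 with h5 | ⟨h5, h7, w', σ, h8, h9, h10⟩
    · exact Or.inl h5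
    · refine Or.inr ⟨h5, by simpa using h7, w', σ, h8, ?_⟩
      have h11 : y - 1 - j₀ = y - (j₀ + 1) := by ring
      simpa [h11] using h10

/-- A tail of a block that ends at a bottom vertex of the block is short. -/
theorem Block.tail_bottom_le (h : Block a κ L i anc s) (hw : w.length = s) {ρ : Bool} {n : ℤ}
    (hQ : Tail a ρ w (s + blockLen κ i) Q n) (hn : (Q n).1.length + 1 = s + blockLen κ i) :
    n ≤ 13 := by
  by_contra hc
  have h1 := (h.slot le_rfl (h.rank_le i h.le).1 ρ).2
  have h2 := four_le_sealLen (κ := κ) i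
  have h3 := blockLen_eq (κ := κ) i
  have h4 := ρ.toNat_le
  set lo := s + coreLen κ i + (sealLen κ i - 1 - (2 * (i - i) + ρ.toNat)) with hlo
  have hp : ∀ t, 2 ≤ t → t < n + 1 → (Q t).2 ≠ none → (Q t).1.length ≠ lo := by
    intro t h5 h6 h7 h8
    refine hQ.not_hub h5 (by omega) h7 ?_
    rw [h8, h1, hw]
    simp
  have h5 := (h.region hw (lo := lo) (by omega) (by omega)
    (hQ.ip.mono (x' := 2) (y' := n + 1) (by omega) le_rfl)
    (fun t h5 h6 => hQ.below t (by omega) (by omega)) hp (t := n) (by omega) (by omega) ?_).2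
  · omega
  · have := hp n (by omega) (by omega)
    unfold Region
    by_cases h6 : (Q n).2 = none
    · simp only [h6, and_true]; omega
    · have := this h6; omega

/-- Bottom vertices of a block whose seal contains the hub `X` lie in the last layer. -/
theorem Block.sealed_bottom_le (h : Block a κ L i anc s) (hij : i ≤ j) (hj : j ≤ κ i)
    (hX : IsRank L j X.1 (Function.update anc i s)) (hw : w.length = s) (hQ : IP a Q x y)
    (hb : ∀ t, x ≤ t → t < y → Below w (s + blockLen κ i) (Q t))
    (hav : ∀ t, x ≤ t → t < y → ¬ Mark a X (Q t)) {t : ℤ} (hx : x ≤ t) (hy : t < y)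
    (ht : (Q t).1.length + 1 = s + blockLen κ i) : y - x ≤ (12 * (j - i) + 13 : ℕ) := by
  have h1 := (h.slot hij hj X.2).2
  have h0 := (h.rank_le i h.le).2
  rw [hX.1 (by omega)] at h1
  have h3 := blockLen_eq (κ := κ) i
  have h4 := X.2.toNat_le
  have h5 : sealLen κ i = 4 * (κ i - i + 1) := rfl
  set lo := s + coreLen κ i + (sealLen κ i - 1 - (2 * (j - i) + X.2.toNat)) with hlo
  have hp : ∀ t, x ≤ t → t < y → (Q t).2 ≠ none → (Q t).1.length ≠ lo := by
    intro t h5 h6 h7 h8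
    exact hav t h5 h6 ⟨h7, by rw [h8, h1]⟩
  have h6 := (h.region hw (lo := lo) (by omega) (by omega) hQ hb hp hx hy ?_).2
  · omega
  · have := hp t hx hy
    unfold Region
    by_cases h6 : (Q t).2 = none
    · simp only [h6, and_true]; omega
    · have := this h6; omega

theorem Block.core_bottom_bottom (h : Block a κ L (i + 1) anc s)
    {B : ℕ} (hw : w.length = s) (hQ : IP a Q x y) (hxy : x < y)
    (hb : ∀ t, x ≤ t → t < y → Below w (s + 2 * blockLen κ i) (Q t))
    (hx : (Q x).1.length + 1 = s + 2 * blockLen κ i)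
    (hy : (Q (y - 1)).1.length + 1 = s + 2 * blockLen κ i)
    (hB : ∀ {w' x' y' s'}, Block a κ L i (Function.update anc (i + 1) s) s' → w'.length = s' →
      x ≤ x' → x' < y' → y' ≤ y →
      (∀ t, x' ≤ t → t < y' → Below w' (s' + blockLen κ i) (Q t)) →
      (Q x').1.length + 1 = s' + blockLen κ i → (Q (y' - 1)).1.length + 1 = s' + blockLen κ i →
      y' - x' ≤ B) : y - x ≤ B + 26 := by
  have hlen := blockLen_eq (κ := κ) i
  have hpos := four_le_sealLen (κ := κ) i
  rcases h.cut_core hw hQ hxy hb with ⟨w', h1, h2⟩ | ⟨x', y', h1, h2, h3, h4, h5, h6⟩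
  · have := hB h.right h1 le_rfl hxy le_rfl h2 (by omega) (by omega)
    omega
  rcases h5 with rfl | ⟨h5, h7, w', σ, h8, h9⟩
  · have := (h4 x le_rfl h2).2
    omega
  rcases h6 with rfl | ⟨h6, h7', w'', σ', h8', h9'⟩
  · have := (h4 (y' - 1) (by omega) (by omega)).2
    omega
  have h10 := h.right.tail_bottom_le h8 h9 (by simp only [sub_sub_cancel]; omega)
  have h11 := h.right.tail_bottom_le h8' h9' (by
    rw [show y' - 1 + (y - y') = y - 1 by ring]; omega)
  have := hB h.left hw h1 h2 h3 h4 h7 h7'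
  omega

theorem Block.bottom_bottom (h : Block a κ L i anc s) (hij : i ≤ j)
    (hX : IsRank L j X.1 (Function.update anc i s)) (hw : w.length = s) (hQ : IP a Q x y)
    (hxy : x < y) (hb : ∀ t, x ≤ t → t < y → Below w (s + blockLen κ i) (Q t))
    (hav : ∀ t, x ≤ t → t < y → ¬ Mark a X (Q t))
    (hx : (Q x).1.length + 1 = s + blockLen κ i)
    (hy : (Q (y - 1)).1.length + 1 = s + blockLen κ i) : y - x ≤ crossBound κ j i := by
  induction i generalizing anc s w x y with
  | zero =>
    by_cases hs : j ≤ κ 0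
    · have := h.sealed_bottom_le hij hs hX hw hQ hb hav le_rfl hxy hx
      rw [crossBound_of_le hs]
      push_cast at this ⊢
      omega
    have h1 := hQ.le_of_hub_le h.hub_le hb
      (fun d h1 h2 => hw ▸ h.seal_le (d := d) (by simp [coreLen]; omega) h2)
    have h2 : s + blockLen κ 0 - w.length = sealLen κ 0 := by simp [hw, blockLen]
    rw [h2] at h1
    have := le_crossBound_zero (κ := κ) (j := j) (by omega)
    omega
  | succ i ih =>
    by_cases hs : j ≤ κ (i + 1)
    · have := h.sealed_bottom_le hij hs hX hw hQ hb hav le_rfl hxy hx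
      rw [crossBound_of_le hs]
      push_cast at this ⊢
      omega
    rw [crossBound_succ (by omega)]
    have hlen := blockLen_eq (κ := κ) (i + 1)
    have hpos := four_le_sealLen (κ := κ) (i + 1)
    rw [coreLen] at hlen
    have hu : s + blockLen κ (i + 1) - (s + 2 * blockLen κ i) = sealLen κ (i + 1) := by omega
    rcases h.cut_seal hw le_rfl hQ hxy hb with h1 | ⟨x', y', h1, h2, h3, h4, h5, h6⟩
    · omega
    rw [hu] at h5 h6
    rcases h5 with rfl | ⟨h5, h7, h8⟩
    · have := (h4 x le_rfl h2).2
      omega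
    rcases h6 with rfl | ⟨h6, h7', h8'⟩
    · have := (h4 (y' - 1) (by omega) (by omega)).2
      omega
    have := h.core_bottom_bottom hw (hQ.mono h1 h3) h2 h4 h7 h7'
      (B := crossBound κ j i) (fun g1 g2 g3 g4 g5 g6 g7 g8 =>
        ih g1 (by omega) (hX.update (by omega) _) g2
          (hQ.mono (by omega) (by omega)) g4 g6 (fun t g9 g10 => hav t (by omega) (by omega)) g7 g8)
    push_cast
    omega

end

/-- Tails in blocks of rank `k` have at most `T + 1` vertices, provided that the block does not start
at the place of one of its ancestors. -/
def TailBound (a : ℕ → ℕ × Bool) (κ : ℕ → ℕ) (L k T : ℕ) : Prop :=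
  ∀ (anc : ℕ → ℕ) (s : ℕ), Block a κ L k anc s → (∀ r, k < r → r ≤ L → anc r < s) →
    ∀ (w : List Bool) (σ : Bool) (Q : ℤ → GVert) (n : ℤ), w.length = s →
      Tail a σ w (s + blockLen κ k) Q n → n ≤ T

section

variable {a : ℕ → ℕ × Bool} {κ : ℕ → ℕ} {L i j s T : ℕ} {anc : ℕ → ℕ} {X : ℕ × Bool}
  {w : List Bool} {Q : ℤ → GVert} {x y : ℤ}

theorem TailBound.right (hT : TailBound a κ L i T) (h : Block a κ L (i + 1) anc s) {σ : Bool} {n : ℤ}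
    (hw : w.length = s + blockLen κ i)
    (hQ : Tail a σ w (s + blockLen κ i + blockLen κ i) Q n) : n ≤ T :=
  hT _ _ h.right (fun _ h1 h2 => h.lt_right h1 h2) w σ Q n hw hQ

theorem Block.core_avoid_bottom_bottom (h : Block a κ L (i + 1) anc s) (hij : i + 1 ≤ j)
    (hX : IsRank L j X.1 (Function.update anc (i + 1) s)) (hw : w.length = s) (hQ : IP a Q x y)
    (hxy : x < y) (hb : ∀ t, x ≤ t → t < y → Below w (s + 2 * blockLen κ i) (Q t))
    (hav : ∀ t, x ≤ t → t < y → ¬ Mark a X (Q t))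
    (hx : (Q x).1.length + 1 = s + 2 * blockLen κ i)
    (hy : (Q (y - 1)).1.length + 1 = s + 2 * blockLen κ i) :
    y - x ≤ (crossBound κ j i + 26 : ℕ) :=
  h.core_bottom_bottom hw hQ hxy hb hx hy (fun g1 g2 g3 g4 g5 g6 g7 g8 =>
    g1.bottom_bottom (by omega) (hX.update (by omega) _) g2
      (hQ.mono (by omega) (by omega)) g4 g6 (fun t g9 g10 => hav t (by omega) (by omega)) g7 g8)

theorem Block.core_bottom_free (h : Block a κ L (i + 1) anc s) (hij : i + 1 ≤ j)
    (hX : IsRank L j X.1 (Function.update anc (i + 1) s)) (hw : w.length = s) (hQ : IP a Q x y)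
    (hxy : x < y) (hb : ∀ t, x ≤ t → t < y → Below w (s + 2 * blockLen κ i) (Q t))
    (hav : ∀ t, x ≤ t → t < y → ¬ Mark a X (Q t))
    (hx : (Q x).1.length + 1 = s + 2 * blockLen κ i) (hT : TailBound a κ L i T)
    (hF : ∀ {w' x' y' s'}, Block a κ L i (Function.update anc (i + 1) s) s' → w'.length = s' →
      x ≤ x' → x' < y' → y' ≤ y →
      (∀ t, x' ≤ t → t < y' → Below w' (s' + blockLen κ i) (Q t)) →
      (Q x').1.length + 1 = s' + blockLen κ i → y' - x' ≤ (2 * crossBound κ j i + T : ℕ)) :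
    y - x ≤ (13 + 2 * crossBound κ j i + T : ℕ) := by
  have hlen := blockLen_eq (κ := κ) i
  have hpos := four_le_sealLen (κ := κ) i
  rcases h.cut_core hw hQ hxy hb with ⟨w', h1, h2⟩ | ⟨x', y', h1, h2, h3, h4, h5, h6⟩
  · have := hF h.right h1 le_rfl hxy le_rfl h2 (by omega)
    push_cast at this ⊢
    omega
  rcases h5 with rfl | ⟨h5, h7, w', σ, h8, h9⟩
  · have := (h4 x le_rfl h2).2
    omega
  have h10 := h.right.tail_bottom_le h8 h9 (by simp only [sub_sub_cancel]; omega)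
  rcases h6 with rfl | ⟨h6, h7', w'', σ', h8', h9'⟩
  · have := hF h.left hw h1 h2 le_rfl h4 h7
    push_cast at this ⊢
    omega
  have h11 := hT.right h h8' h9'
  have := h.left.bottom_bottom (by omega) (hX.update (by omega) _) hw (hQ.mono h1 h3) h2 h4
    (fun t g9 g10 => hav t (by omega) (by omega)) h7 h7'
  push_cast at this ⊢
  omega

theorem Block.bottom_free (h : Block a κ L i anc s) (hij : i ≤ j)
    (hX : IsRank L j X.1 (Function.update anc i s)) (hw : w.length = s) (hQ : IP a Q x y)
    (hxy : x < y) (hb : ∀ t, x ≤ t → t < y → Below w (s + blockLen κ i) (Q t))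
    (hav : ∀ t, x ≤ t → t < y → ¬ Mark a X (Q t))
    (hx : (Q x).1.length + 1 = s + blockLen κ i) (hT : ∀ k < i, TailBound a κ L k T) :
    y - x ≤ (2 * crossBound κ j i + T : ℕ) := by
  induction i generalizing anc s w x y with
  | zero =>
    by_cases hs : j ≤ κ 0
    · have := h.sealed_bottom_le hij hs hX hw hQ hb hav le_rfl hxy hx
      rw [crossBound_of_le hs]
      push_cast at this ⊢
      omega
    have h1 := hQ.le_of_hub_le h.hub_le hb
      (fun d h1 h2 => hw ▸ h.seal_le (d := d) (by simp [coreLen]; omega) h2)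
    have h2 : s + blockLen κ 0 - w.length = sealLen κ 0 := by simp [hw, blockLen]
    rw [h2] at h1
    have := le_crossBound_zero (κ := κ) (j := j) (by omega)
    push_cast
    omega
  | succ i ih =>
    by_cases hs : j ≤ κ (i + 1)
    · have := h.sealed_bottom_le hij hs hX hw hQ hb hav le_rfl hxy hx
      rw [crossBound_of_le hs]
      push_cast at this ⊢
      omega
    rw [crossBound_succ (by omega)]
    have hlen := blockLen_eq (κ := κ) (i + 1)
    have hpos := four_le_sealLen (κ := κ) (i + 1)
    rw [coreLen] at hlen
    have hu : s + blockLen κ (i + 1) - (s + 2 * blockLen κ i) = sealLen κ (i + 1) := by omega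
    rcases h.cut_seal hw le_rfl hQ hxy hb with h1 | ⟨x', y', h1, h2, h3, h4, h5, h6⟩
    · push_cast
      omega
    rw [hu] at h5 h6
    rcases h5 with rfl | ⟨h5, h7, h8⟩
    · have := (h4 x le_rfl h2).2
      omega
    have := h.core_bottom_free hij hX hw (hQ.mono h1 h3) h2 h4
      (fun t g9 g10 => hav t (by omega) (by omega)) h7 (hT i (by omega))
      (fun g1 g2 g3 g4 g5 g6 g7 => ih g1 (by omega) (hX.update (by omega) _) g2
        (hQ.mono (by omega) (by omega)) g4 g6 (fun t g9 g10 => hav t (by omega) (by omega)) g7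
        (fun k hk => hT k (by omega)))
    push_cast at this ⊢
    omega

theorem Block.core_avoid_bottom_free (h : Block a κ L (i + 1) anc s) (hij : i + 1 ≤ j)
    (hX : IsRank L j X.1 (Function.update anc (i + 1) s)) (hw : w.length = s) (hQ : IP a Q x y)
    (hxy : x < y) (hb : ∀ t, x ≤ t → t < y → Below w (s + 2 * blockLen κ i) (Q t))
    (hav : ∀ t, x ≤ t → t < y → ¬ Mark a X (Q t))
    (hx : (Q x).1.length + 1 = s + 2 * blockLen κ i) (hT : ∀ k ≤ i, TailBound a κ L k T) :
    y - x ≤ (13 + 2 * crossBound κ j i + T : ℕ) :=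
  h.core_bottom_free hij hX hw hQ hxy hb hav hx (hT i le_rfl)
    (fun g1 g2 g3 g4 g5 g6 g7 => g1.bottom_free (by omega) (hX.update (by omega) _) g2
      (hQ.mono (by omega) (by omega)) g4 g6 (fun t g9 g10 => hav t (by omega) (by omega)) g7
      (fun k hk => hT k (by omega)))

/-- A tail in a block whose last vertex is the first in the neighbourhood of an older
vertex `X` is short. -/
theorem Block.tail_mark_le (h : Block a κ L i anc s) (hanc : ∀ r, i < r → r ≤ L → anc r < s)
    (hij : i < j) (hj : j ≤ L) (hX : IsRank L j X.1 (Function.update anc i s)) (hw : w.length = s)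
    {ρ : Bool} {n : ℤ} (hQ : Tail a ρ w (s + blockLen κ i) Q n) (hn : 1 ≤ n) (hm : Mark a X (Q n))
    (hav : ∀ t, 1 ≤ t → t < n → ¬ Mark a X (Q t)) : n ≤ (12 * (j - i) + 8 : ℕ) := by
  have hρ := ρ.toNat_le
  have hσ := X.2.toNat_le
  have hbn := hQ.below n hn le_rfl
  have hXs : X.1 < s := by
    have := hX.1 hj
    rw [Function.update_of_ne (by omega)] at this
    rw [← this]
    exact hanc j hij hj
  obtain ⟨k, s', anc', h1, h2, h3, h4, h5, h6, h7, h8, h9⟩ := h.locate (d := (Q n).1.length)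
    (hw ▸ hbn.1.length_le) hbn.2
  obtain ⟨off, hoff⟩ := Nat.exists_eq_add_of_le h3
  have hoff' : off < sealLen κ k := by omega
  set o := min off (sealLen κ k - 1 - off) with ho
  have hrk := h.rank_le k (by have := h.le; omega)
  have hr := sealHub_rank hoff'
  rw [← ho] at hr
  have hmX := hm.2
  rw [hoff, h6 off hoff', sealHub, ← ho] at hmX
  set r := k + o / 2 with hrdef
  have hX1 : anc' r = X.1 := by rw [← hmX]
  have hX2 : decide (o % 2 = 1) = X.2 := by rw [← hmX]
  have hir : i < r := by
    by_contra hc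
    have := h8 r (by omega) (by omega)
    omega
  have hrj : r ≤ j := by
    by_contra hc
    exact hX.2 r (by omega) (by omega) (by rw [← h7 r (by omega), hX1])
  have hz : sealLen κ k = 4 * (κ k - k + 1) := rfl
  set o' := 2 * (i - k) + ρ.toNat with ho'
  have hslot : sealHub κ k anc' o' = (s, ρ) := by
    rw [sealHub_slot h1 (by omega), h7 i le_rfl]
    simp
  have hoo : o' < o := by omega
  have hoz : 2 * o < sealLen κ k := by omega
  -- hubs strictly between the two slots of the start
  have hmid : ∀ d, s' + o' < d → d < s' + (sealLen κ k - 1 - o') → (a d).1 ≤ s := by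
    intro d g1 g2
    obtain ⟨f, rfl⟩ := Nat.exists_eq_add_of_le (show s' ≤ d by omega)
    have g3 : f < sealLen κ k := by omega
    have g4 := sealHub_rank g3
    rw [h6 f g3, sealHub]
    simp only
    rw [h7 _ (by omega)]
    exact h.update_le (by omega) (by omega)
  have hinner : ∀ d, s' + o ≤ d → d ≤ s' + (sealLen κ k - 1 - o) → (a d).1 < s := by
    intro d g1 g2
    obtain ⟨f, rfl⟩ := Nat.exists_eq_add_of_le (show s' ≤ d by omega)
    have g3 : f < sealLen κ k := by omega
    have g4 := sealHub_rank g3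
    rw [h6 f g3, sealHub]
    simp only
    rw [h7 _ (by omega), Function.update_of_ne (by omega)]
    exact hanc _ (by omega) (by omega)
  have hno : ∀ lo hi, s' ≤ lo → hi < s' + sealLen κ k → ∀ d, w.length ≤ d →
      d < s + blockLen κ i → ¬ (lo < (a d).1 ∧ (a d).1 ≤ hi) := by
    intro lo hi g1 g2 d g3 g4 g5
    exact h9 d (by omega) g4 ⟨by omega, by omega⟩
  by_cases hn3 : n ≤ 2
  · push_cast
    omega
  have hpy : ∀ t, 2 ≤ t → t < n + 1 → (Q t).2 ≠ none →
      (Q t).1.length ≠ s' + o' ∧ (Q t).1.length ≠ s' + (sealLen κ k - 1 - o') := by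
    intro t g1 g2 g3
    have g4 := hQ.not_hub g1 (by omega) g3
    constructor
    · intro g5
      exact g4 (by rw [g5, h6 _ (by omega), hslot, hw])
    · intro g5
      exact g4 (by rw [g5, h6 _ (by omega), sealHub_mirror (by omega), hslot, hw])
  have houter := (IP.region h.hub_le (hQ.ip.mono (x' := 2) (y' := n + 1) (by omega) le_rfl)
    (fun t g1 g2 => hQ.below t (by omega) (by omega)) (lo := s' + o')
    (hi := s' + (sealLen κ k - 1 - o')) (by omega) (by omega)
    (fun d g1 g2 => hw ▸ hmid d g1 g2) (hno _ _ (by omega) (by omega)) hpy (t := n) (by omega)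
    (by omega) (Or.inr ⟨by omega, by omega⟩)).1
  have hpX : ∀ t, 1 ≤ t → t < n → (Q t).2 ≠ none →
      (Q t).1.length ≠ s' + o ∧ (Q t).1.length ≠ s' + (sealLen κ k - 1 - o) := by
    intro t g1 g2 g3
    have g4 : sealHub κ k anc' o = X := by
      rw [← hmX, sealHub, show min o (sealLen κ k - 1 - o) = o by omega]
    constructor
    · intro g5
      exact hav t g1 g2 ⟨g3, by rw [g5, h6 _ (by omega), g4]⟩
    · intro g5
      exact hav t g1 g2 ⟨g3, by rw [g5, h6 _ (by omega), sealHub_mirror (by omega), g4]⟩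
  have hnot : ¬ Region (s' + o) (s' + (sealLen κ k - 1 - o)) (Q 2) := by
    intro hR
    have h10 := (IP.region h.hub_le (hQ.ip.mono (x' := 1) (y' := n) (by omega) (by omega))
      (fun t g1 g2 => hQ.below t (by omega) (by omega)) (lo := s' + o)
      (hi := s' + (sealLen κ k - 1 - o)) (by omega) (by omega)
      (fun d g1 g2 => hw ▸ hmid d (by omega) (by omega)) (hno _ _ (by omega) (by omega)) hpX (t := 2)
      (by omega) (by omega) hR).1 1 le_rfl (by omega)
    obtain ⟨h11, h12⟩ := hQ.length_ge h.hub_le hn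
    rcases h10 with h10 | h10
    · exact h11 h10.2
    rcases h12 with h12 | h12
    · rw [h12.1] at h10
      omega
    · have := hinner (Q 1).1.length (by omega) (by omega)
      rw [h12, hw] at this
      exact absurd this (lt_irrefl _)
  have hp2 := hpX 2 (by omega) (by omega)
  have h2r := houter 2 le_rfl (by omega)
  have hav' : ∀ t, 2 ≤ t → t < n → (Q t).2 ≠ none → _ := fun t g1 g2 g3 =>
    And.intro (hpy t g1 (by omega) g3) (hpX t (by omega) g2 g3)
  unfold Region at h2r hnot
  have hcase : Region (s' + o') (s' + o) (Q 2) ∨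
      Region (s' + (sealLen κ k - 1 - o)) (s' + (sealLen κ k - 1 - o')) (Q 2) := by
    unfold Region
    by_cases hq : (Q 2).2 = none
    · simp only [hq, and_true] at h2r hnot ⊢
      omega
    · have := hp2 hq
      simp only [hq, and_false, false_or] at h2r hnot ⊢
      omega
  rcases hcase with hc | hc
  · have := (IP.region h.hub_le (hQ.ip.mono (x' := 2) (y' := n) (by omega) (by omega))
      (fun t g1 g2 => hQ.below t (by omega) (by omega)) (by omega) (by omega)
      (fun d g1 g2 => hw ▸ hmid d (by omega) (by omega)) (hno _ _ (by omega) (by omega))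
      (fun t g1 g2 g3 => ⟨(hav' t g1 g2 g3).1.1, (hav' t g1 g2 g3).2.1⟩) (t := 2)
      (by omega) (by omega) hc).2
    push_cast
    omega
  · have := (IP.region h.hub_le (hQ.ip.mono (x' := 2) (y' := n) (by omega) (by omega))
      (fun t g1 g2 => hQ.below t (by omega) (by omega)) (by omega) (by omega)
      (fun d g1 g2 => hw ▸ hmid d (by omega) (by omega)) (hno _ _ (by omega) (by omega))
      (fun t g1 g2 g3 => ⟨(hav' t g1 g2 g3).2.2, (hav' t g1 g2 g3).1.2⟩) (t := 2)
      (by omega) (by omega) hc).2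
    push_cast
    omega

end

section

variable {a : ℕ → ℕ × Bool} {κ : ℕ → ℕ} {L i j s M : ℕ} {anc : ℕ → ℕ} {X : ℕ × Bool}
  {w : List Bool} {Q : ℤ → GVert} {x y : ℤ} {τ : ℕ → ℕ}

theorem Block.core_mark_bottom (h : Block a κ L (i + 1) anc s) (hij : i + 1 ≤ j) (hj : j ≤ L)
    (hX : IsRank L j X.1 (Function.update anc (i + 1) s)) (hw : w.length = s) (hQ : IP a Q x y)
    (hxy : x < y) (hb : ∀ t, x ≤ t → t < y → Below w (s + 2 * blockLen κ i) (Q t))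
    (hx : Mark a X (Q x)) (hav : ∀ t, x < t → t < y → ¬ Mark a X (Q t))
    (hy : (Q (y - 1)).1.length + 1 = s + 2 * blockLen κ i)
    (hB : ∀ {w' y' s'}, Block a κ L i (Function.update anc (i + 1) s) s' → w'.length = s' →
      x < y' → y' ≤ y → (∀ t, x ≤ t → t < y' → Below w' (s' + blockLen κ i) (Q t)) →
      (Q (y' - 1)).1.length + 1 = s' + blockLen κ i → y' - x ≤ (2 * crossBound κ j i : ℕ)) :
    y - x ≤ (13 + 2 * crossBound κ j i : ℕ) := by
  have hlen := blockLen_eq (κ := κ) i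
  have hpos := four_le_sealLen (κ := κ) i
  rcases h.cut_core hw hQ hxy hb with ⟨w', h1, h2⟩ | ⟨x', y', h1, h2, h3, h4, h5, h6⟩
  · have := hB h.right h1 hxy le_rfl h2 (by omega)
    push_cast at this ⊢
    omega
  rcases h6 with rfl | ⟨h6, h7', w'', σ', h8', h9'⟩
  · have := (h4 (y' - 1) (by omega) (by omega)).2
    omega
  have h11 := h.right.tail_bottom_le h8' h9' (by
    rw [show y' - 1 + (y - y') = y - 1 by ring]; omega)
  rcases h5 with rfl | ⟨h5, h7, w', σ, h8, h9⟩
  · have := hB h.left hw h2 h3 h4 h7'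
    push_cast at this ⊢
    omega
  have h10 := h.right.tail_mark_le (fun _ h1 h2 => h.lt_right h1 h2) (by omega) hj
    (hX.update (by omega) _) h8 h9 (by omega) (by simpa using hx)
    (fun t h1 h2 => hav _ (by omega) (by omega))
  have h12 := h.left.bottom_bottom (by omega) (hX.update (by omega) _) hw (hQ.mono h1 h3) h2 h4
    (fun t g9 g10 => hav t (by omega) (by omega)) h7 h7'
  have := le_crossBound (κ := κ) (i := i) (j := j)
  push_cast at h10 ⊢
  omega

theorem Block.mark_bottom (h : Block a κ L i anc s) (hij : i ≤ j) (hj : j ≤ L)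
    (hX : IsRank L j X.1 (Function.update anc i s)) (hw : w.length = s) (hQ : IP a Q x y)
    (hxy : x < y) (hb : ∀ t, x ≤ t → t < y → Below w (s + blockLen κ i) (Q t))
    (hx : Mark a X (Q x)) (hav : ∀ t, x < t → t < y → ¬ Mark a X (Q t))
    (hy : (Q (y - 1)).1.length + 1 = s + blockLen κ i) :
    y - x ≤ (2 * crossBound κ j i : ℕ) := by
  have hsealed : j ≤ κ i → y - x ≤ (2 * crossBound κ j i : ℕ) := by
    intro hs
    have h0 := le_crossBound (κ := κ) (i := i) (j := j)
    by_cases h1 : x + 1 < y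
    · have := h.sealed_bottom_le hij hs hX hw (hQ.mono (x' := x + 1) (by omega) le_rfl)
        (fun t h2 h3 => hb t (by omega) h3) (fun t h2 h3 => hav t (by omega) h3)
        (t := y - 1) (by omega) (by omega) hy
      push_cast at this ⊢
      omega
    · push_cast
      omega
  induction i generalizing anc s w x y with
  | zero =>
    by_cases hs : j ≤ κ 0
    · exact hsealed hs
    have h1 := hQ.le_of_hub_le h.hub_le hb
      (fun d h1 h2 => hw ▸ h.seal_le (d := d) (by simp [coreLen]; omega) h2)
    have h2 : s + blockLen κ 0 - w.length = sealLen κ 0 := by simp [hw, blockLen]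
    rw [h2] at h1
    have := le_crossBound_zero (κ := κ) (j := j) (by omega)
    push_cast
    omega
  | succ i ih =>
    by_cases hs : j ≤ κ (i + 1)
    · exact hsealed hs
    rw [crossBound_succ (by omega)]
    have hlen := blockLen_eq (κ := κ) (i + 1)
    have hpos := four_le_sealLen (κ := κ) (i + 1)
    rw [coreLen] at hlen
    have hu : s + blockLen κ (i + 1) - (s + 2 * blockLen κ i) = sealLen κ (i + 1) := by omega
    rcases h.cut_seal hw le_rfl hQ hxy hb with h1 | ⟨x', y', h1, h2, h3, h4, h5, h6⟩
    · push_cast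
      omega
    rw [hu] at h5 h6
    rcases h6 with rfl | ⟨h6, h7', h8'⟩
    · have := (h4 (y' - 1) (by omega) (by omega)).2
      omega
    rcases h5 with rfl | ⟨h5, h7, h8⟩
    · have := h.core_mark_bottom hij hj hX hw (hQ.mono h1 h3) h2 h4 hx
        (fun t g9 g10 => hav t g9 (by omega)) h7'
        (fun {w' y'' s'} g1 g2 g3 g4 g5 g6 => ih g1 (by omega) (hX.update (by omega) _) g2
          (hQ.mono le_rfl (by omega)) g3 g5 hx (fun t g9 g10 => hav t g9 (by omega)) g6 ?_)
      · push_cast at this ⊢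
        omega
      · intro hs
        have h0 := le_crossBound (κ := κ) (i := i) (j := j)
        by_cases h1 : x + 1 < y''
        · have := g1.sealed_bottom_le (by omega) hs (hX.update (by omega) _) g2
            (hQ.mono (x' := x + 1) (by omega) (by omega))
            (fun t h2 h3 => g5 t (by omega) h3) (fun t h2 h3 => hav t (by omega) (by omega))
            (t := y'' - 1) (by omega) (by omega) g6
          push_cast at this ⊢
          omega
        · push_cast
          omega
    · have := h.core_avoid_bottom_bottom hij hX hw (hQ.mono h1 h3) h2 h4
        (fun t g9 g10 => hav t (by omega) (by omega)) h7 h7'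
      push_cast at this ⊢
      omega

theorem Block.core_avoid_mark_bottom (h : Block a κ L (i + 1) anc s) (hij : i + 1 ≤ j) (hj : j ≤ L)
    (hX : IsRank L j X.1 (Function.update anc (i + 1) s)) (hw : w.length = s) (hQ : IP a Q x y)
    (hxy : x < y) (hb : ∀ t, x ≤ t → t < y → Below w (s + 2 * blockLen κ i) (Q t))
    (hx : Mark a X (Q x)) (hav : ∀ t, x < t → t < y → ¬ Mark a X (Q t))
    (hy : (Q (y - 1)).1.length + 1 = s + 2 * blockLen κ i) :
    y - x ≤ (13 + 2 * crossBound κ j i : ℕ) :=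
  h.core_mark_bottom hij hj hX hw hQ hxy hb hx hav hy
    (fun g1 g2 g3 g4 g5 g6 => g1.mark_bottom (by omega) hj (hX.update (by omega) _) g2
      (hQ.mono le_rfl (by omega)) g3 g5 hx (fun t g9 g10 => hav t g9 (by omega)) g6)

theorem Block.core_mark_free (h : Block a κ L (i + 1) anc s) (hij : i + 1 ≤ j) (hj : j ≤ L)
    (hX : IsRank L j X.1 (Function.update anc (i + 1) s)) (hw : w.length = s) (hQ : IP a Q x y)
    (hxy : x < y) (hb : ∀ t, x ≤ t → t < y → Below w (s + 2 * blockLen κ i) (Q t))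
    (hx : Mark a X (Q x)) (hav : ∀ t, x < t → t < y → ¬ Mark a X (Q t))
    (hT : ∀ k ≤ i, TailBound a κ L k (τ i)) (hM : 3 * crossBound κ j i + τ i ≤ M)
    (hB : ∀ {w' s'}, Block a κ L i (Function.update anc (i + 1) s) s' → w'.length = s' →
      (∀ t, x ≤ t → t < y → Below w' (s' + blockLen κ i) (Q t)) → y - x ≤ M) :
    y - x ≤ M := by
  rcases h.cut_core hw hQ hxy hb with ⟨w', h1, h2⟩ | ⟨x', y', h1, h2, h3, h4, h5, h6⟩
  · exact hB h.right h1 h2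
  rcases h5 with rfl | ⟨h5, h7, w', σ, h8, h9⟩
  · rcases h6 with rfl | ⟨h6, h7', w'', σ', h8', h9'⟩
    · exact hB h.left hw h4
    have h11 := (hT i le_rfl).right h h8' h9'
    have := h.left.mark_bottom (by omega) hj (hX.update (by omega) _) hw (hQ.mono h1 h3) h2 h4 hx
      (fun t g9 g10 => hav t (by omega) (by omega)) h7'
    push_cast at this
    omega
  have h10 := h.right.tail_mark_le (fun _ h1 h2 => h.lt_right h1 h2) (by omega) hj
    (hX.update (by omega) _) h8 h9 (by omega) (by simpa using hx)
    (fun t h1 h2 => hav _ (by omega) (by omega))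
  have h0 := le_crossBound (κ := κ) (i := i) (j := j)
  rcases h6 with rfl | ⟨h6, h7', w'', σ', h8', h9'⟩
  · have := h.left.bottom_free (by omega) (hX.update (by omega) _) hw (hQ.mono h1 h3) h2 h4
      (fun t g9 g10 => hav t (by omega) (by omega)) h7 (fun k hk => hT k hk.le)
    push_cast at this h10
    omega
  have h11 := (hT i le_rfl).right h h8' h9'
  have := h.left.bottom_bottom (by omega) (hX.update (by omega) _) hw (hQ.mono h1 h3) h2 h4
    (fun t g9 g10 => hav t (by omega) (by omega)) h7 h7'
  push_cast at h10
  omega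

theorem Block.trunc_bottom_free (h : Block a κ L (i + 1) anc s) (hij : i + 1 ≤ j)
    (hX : IsRank L j X.1 (Function.update anc (i + 1) s)) (hw : w.length = s) {u : ℕ}
    (hu : u ≤ s + blockLen κ (i + 1)) (hu' : s + 2 * blockLen κ i ≤ u) (hQ : IP a Q x y)
    (hxy : x < y) (hb : ∀ t, x ≤ t → t < y → Below w u (Q t))
    (hx : (Q x).1.length + 1 = s + 2 * blockLen κ i ∨ (Q x).1.length + 1 = u)
    (hav : ∀ t, x ≤ t → t < y → ¬ Mark a X (Q t)) (hT : ∀ k ≤ i, TailBound a κ L k (τ i)) :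
    y - x ≤ (6 * (u - (s + 2 * blockLen κ i)) + 26 + 2 * crossBound κ j i + τ i : ℕ) := by
  rcases h.cut_seal hw hu hQ hxy hb with h1 | ⟨x', y', h1, h2, h3, h4, h5, h6⟩
  · push_cast at h1 ⊢
    omega
  have h7 : (Q x').1.length + 1 = s + 2 * blockLen κ i ∧
      x' - x ≤ 3 * (u - (s + 2 * blockLen κ i) : ℕ) := by
    rcases h5 with rfl | ⟨h5, h7, h8⟩
    · have := (h4 x le_rfl h2).2
      exact ⟨by omega, by omega⟩
    · exact ⟨h7, h8⟩
  clear h5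
  obtain ⟨h7, h8⟩ := h7
  rcases h6 with rfl | ⟨h6, h7', h8'⟩
  · have := h.core_avoid_bottom_free hij hX hw (hQ.mono h1 h3) h2 h4
      (fun t g9 g10 => hav t (by omega) (by omega)) h7 hT
    push_cast at this ⊢
    omega
  · have := h.core_avoid_bottom_bottom hij hX hw (hQ.mono h1 h3) h2 h4
      (fun t g9 g10 => hav t (by omega) (by omega)) h7 h7'
    push_cast at this ⊢
    omega

theorem Block.trunc_mark_free (h : Block a κ L (i + 1) anc s) (hij : i + 1 ≤ j) (hj : j ≤ L)
    (hX : IsRank L j X.1 (Function.update anc (i + 1) s)) (hw : w.length = s) {u : ℕ}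
    (hu : u ≤ s + blockLen κ (i + 1)) (hQ : IP a Q x y)
    (hxy : x < y) (hb : ∀ t, x ≤ t → t < y → Below w u (Q t))
    (hx : Mark a X (Q x)) (hav : ∀ t, x < t → t < y → ¬ Mark a X (Q t))
    (hT : ∀ k ≤ i, TailBound a κ L k (τ i)) (hM : 3 * crossBound κ j i + τ i ≤ M)
    (hM' : 6 * (u - (s + 2 * blockLen κ i)) + 26 + 2 * crossBound κ j i + τ i ≤ M)
    (hB : ∀ {w' s'}, Block a κ L i (Function.update anc (i + 1) s) s' → w'.length = s' →
      (∀ t, x ≤ t → t < y → Below w' (s' + blockLen κ i) (Q t)) → y - x ≤ M) :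
    y - x ≤ M := by
  rcases h.cut_seal hw hu hQ hxy hb with h1 | ⟨x', y', h1, h2, h3, h4, h5, h6⟩
  · omega
  rcases h5 with rfl | ⟨h5, h7, h8⟩
  · rcases h6 with rfl | ⟨h6, h7', h8'⟩
    · exact h.core_mark_free hij hj hX hw hQ hxy h4 hx hav hT hM hB
    · have := h.core_avoid_mark_bottom hij hj hX hw (hQ.mono h1 h3) h2 h4 hx
        (fun t g9 g10 => hav t (by omega) (by omega)) h7'
      push_cast at this
      omega
  rcases h6 with rfl | ⟨h6, h7', h8'⟩
  · have := h.core_avoid_bottom_free hij hX hw (hQ.mono h1 h3) h2 h4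
      (fun t g9 g10 => hav t (by omega) (by omega)) h7 hT
    push_cast at this
    omega
  · have := h.core_avoid_bottom_bottom hij hX hw (hQ.mono h1 h3) h2 h4
      (fun t g9 g10 => hav t (by omega) (by omega)) h7 h7'
    push_cast at this
    omega

theorem Block.mark_free (h : Block a κ L i anc s) (hij : i ≤ j) (hj : j ≤ L)
    (hX : IsRank L j X.1 (Function.update anc i s)) (hw : w.length = s) (hQ : IP a Q x y)
    (hxy : x < y) (hb : ∀ t, x ≤ t → t < y → Below w (s + blockLen κ i) (Q t))
    (hx : Mark a X (Q x)) (hav : ∀ t, x < t → t < y → ¬ Mark a X (Q t))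
    (hτ : Monotone τ) (hT : ∀ k < i, TailBound a κ L k (τ k)) (hM : ∀ k ≤ i, 6 * sealLen κ k + 1 ≤ M)
    (hM' : ∀ k < i, crossBound κ j (k + 1) + 3 * crossBound κ j k + 20 + τ k ≤ M) :
    y - x ≤ M := by
  induction i generalizing anc s w with
  | zero =>
    have h1 := hQ.le_of_hub_le h.hub_le hb
      (fun d h1 h2 => hw ▸ h.seal_le (d := d) (by simp [coreLen]; omega) h2)
    have h2 : s + blockLen κ 0 - w.length = sealLen κ 0 := by simp [hw, blockLen]
    rw [h2] at h1
    have := hM 0 le_rfl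
    omega
  | succ i ih =>
    have hlen := blockLen_eq (κ := κ) (i + 1)
    have hpos := four_le_sealLen (κ := κ) (i + 1)
    rw [coreLen] at hlen
    have hMi := hM (i + 1) le_rfl
    have hMi' := hM' i (by omega)
    have hTi : ∀ k ≤ i, TailBound a κ L k (τ i) := fun k hk anc s g1 g2 w σ Q n g3 g4 =>
      (hT k (by omega) anc s g1 g2 w σ Q n g3 g4).trans (by exact_mod_cast hτ hk)
    have hB : ∀ {w' s'}, Block a κ L i (Function.update anc (i + 1) s) s' → w'.length = s' →
        (∀ t, x ≤ t → t < y → Below w' (s' + blockLen κ i) (Q t)) → y - x ≤ M :=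
      fun g1 g2 g3 => ih g1 (by omega) (hX.update (by omega) _) g2 g3
        (fun k hk => hT k (by omega)) (fun k hk => hM k (by omega)) (fun k hk => hM' k (by omega))
    by_cases hs : κ (i + 1) < j
    · have h1 := crossBound_succ hs
      exact h.trunc_mark_free hij hj hX hw le_rfl hQ hxy hb hx hav hTi (by omega) (by omega) hB
    have h1 := (h.slot hij (by omega) X.2).1
    rw [hX.1 hj, coreLen] at h1
    have hσ := X.2.toNat_le
    have hz : sealLen κ (i + 1) = 4 * (κ (i + 1) - (i + 1) + 1) := rfl
    have h0 := le_crossBound (κ := κ) (i := i + 1) (j := j)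
    set u := s + 2 * blockLen κ i + (2 * (j - (i + 1)) + X.2.toNat) with hu
    have hue : u < s + blockLen κ (i + 1) := by omega
    have hp : ∀ t, x < t → t < y → (Q t).2 ≠ none → (Q t).1.length ≠ u :=
      fun t g1 g2 g3 g4 => hav t g1 g2 ⟨g3, by rw [g4, h1]⟩
    have hreg : ∀ t, x + 1 ≤ t → t < y → u ≤ (Q t).1.length →
        Region u (s + blockLen κ (i + 1)) (Q (x + 1)) ∧ y - (x + 1) ≤ 6 * sealLen κ (i + 1) := by
      intro t g1 g2 g3
      have g4 := h.region hw (lo := u) (by rw [coreLen]; omega) hue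
        (hQ.mono (x' := x + 1) (by omega) le_rfl) (fun t g5 g6 => hb t (by omega) g6)
        (fun t g5 g6 => hp t (by omega) g6) g1 g2 (by
          have g4 := hp t (by omega) g2
          have g5 := (hb t (by omega) g2).2
          unfold Region
          by_cases g6 : (Q t).2 = none
          · simp only [g6, and_true]; omega
          · have := g4 g6; omega)
      exact ⟨g4.1 _ le_rfl (by omega), by omega⟩
    have hxs := (hb x le_rfl hxy).1.length_le
    have hseal : ∀ d, s + 2 * blockLen κ i ≤ d → d < s + blockLen κ (i + 1) → (a d).1 ≤ s :=
      fun d g1 g2 => h.seal_le g1 g2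
    rcases lt_or_ge (Q x).1.length u with hxu | hxu
    · have hlow : ∀ t, x ≤ t → t < y → Below w u (Q t) := by
        intro t g1 g2
        refine ⟨(hb t g1 g2).1, ?_⟩
        by_contra hc
        have hxt : x ≠ t := by rintro rfl; omega
        have g3 := (hreg t (by omega) g2 (by omega)).1
        have g4 := (hb (x + 1) (by omega) (by omega)).2
        rcases hQ.adj (i := x) le_rfl (by omega) with g5 | (⟨g5, g6, g7⟩ | ⟨c, g5, g6 | g6⟩)
        · have := g5.length_le
          rcases g3 with g3 | g3 <;> omega
        · rw [Region, ← g6] at g3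
          rcases g3 with g3 | g3 <;> omega
        · have := g6.length
          rcases g3 with g3 | g3
          · simp [g5] at g3
          · omega
        · have := g6.length
          rw [length_suf (h.hub_le _)] at this
          have := hseal (Q (x + 1)).1.length (by rcases g3 with g3 | g3 <;> omega) g4
          omega
      exact h.trunc_mark_free hij hj hX hw hue.le hQ hxy hlow hx hav hTi (by omega) (by omega) hB
    rcases hxu.eq_or_lt with hxu | hxu
    swap
    · have := (h.region hw (lo := u) (by rw [coreLen]; omega) hue hQ hb (fun t g1 g2 g3 => by
        rcases g1.eq_or_lt with rfl | g1
        · exact hxu.ne'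
        · exact hp t g1 g2 g3) le_rfl hxy (Or.inr ⟨hxu, (hb x le_rfl hxy).2⟩)).2
      omega
    by_cases hx1 : x + 1 < y
    swap
    · omega
    by_cases hex : ∃ t, x + 1 ≤ t ∧ t < y ∧ u ≤ (Q t).1.length
    · obtain ⟨t, g1, g2, g3⟩ := hex
      have := (hreg t g1 g2 g3).2
      omega
    push Not at hex
    have hx1' := hex (x + 1) le_rfl hx1
    have hx1s := (hb (x + 1) (by omega) hx1).1.length_le
    have hbot : (Q (x + 1)).1.length + 1 = u := by
      rcases hQ.adj (i := x) le_rfl hx1 with (⟨g5, g6, g7⟩ | ⟨c, g5, g6 | g6⟩) | g5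
      · rw [g6] at hx1'
        omega
      · have := g6.length
        omega
      · have := g6.length
        rw [length_suf (h.hub_le _), ← hxu, h1] at this
        have := hseal u (by omega) hue
        rw [h1] at this
        omega
      · have := g5.length_le
        omega
    have := h.trunc_bottom_free hij hX hw hue.le (by omega)
      (hQ.mono (x' := x + 1) (by omega) le_rfl) hx1
      (fun t g5 g6 => ⟨(hb t (by omega) g6).1, hex t g5 g6⟩) (Or.inr hbot)
      (fun t g5 g6 => hav t (by omega) g6) hTi
    push_cast at this
    omega

/-- Bound for tails of a block of rank `j` in terms of the bounds for smaller ranks. -/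
theorem tailBound_of_lt (hj : j ≤ L) (hτ : Monotone τ) (hT : ∀ k < j, TailBound a κ L k (τ k))
    (hM : ∀ k ≤ j, 6 * sealLen κ k + 1 ≤ M)
    (hM' : ∀ k < j, crossBound κ j (k + 1) + 3 * crossBound κ j k + 20 + τ k ≤ M) :
    TailBound a κ L j M := by
  intro anc s h hanc w σ Q n hw hQ
  by_cases hn : 1 ≤ n
  swap
  · omega
  obtain ⟨h1, h2⟩ := hQ.length_ge h.hub_le hn
  have hlen := blockLen_eq (κ := κ) j
  have hpos := four_le_sealLen (κ := κ) j
  have hrank : IsRank L j s (Function.update anc j s) := by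
    refine ⟨fun _ => by simp, fun r g1 g2 => ?_⟩
    rw [Function.update_of_ne (by omega)]
    exact (hanc r g1 g2).ne
  by_cases h3 : a (Q 1).1.length = (s, σ)
  · have := h.mark_free (X := (s, σ)) le_rfl hj hrank hw
      (hQ.ip.mono (x' := 1) (y' := n + 1) (by omega) le_rfl) (by omega)
      (fun t g1 g2 => hQ.below t g1 (by omega)) ⟨h1, h3⟩
      (fun t g1 g2 g3 => hQ.not_hub (i := t) (by omega) (by omega) g3.1 (by rw [g3.2, hw]))
      hτ hT hM hM'
    omega
  obtain ⟨h4, h5⟩ := h2.resolve_right (fun g => h3 (by rw [g, hw]))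
  obtain ⟨k, s', anc', g1, g2, g3, g4, g5, g6, g7, g8, g9⟩ := h.locate (d := s) le_rfl (by omega)
  obtain rfl : s' = s := by omega
  have hk := four_le_sealLen (κ := κ) k
  have hz : sealLen κ k = 4 * (κ k - k + 1) := rfl
  have hrk := (h.rank_le k (by omega)).1
  have hslot : ∀ σ : Bool, a (s' + σ.toNat) = (s', σ) := by
    have g10 : ∀ σ : Bool, a (s' + σ.toNat) = (anc' k, σ) := by
      intro σ
      have g11 := σ.toNat_le
      rw [g6 _ (by omega)]
      have := sealHub_slot (κ := κ) (anc := anc') (le_refl k) hrk σ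
      simpa using this
    have g11 := h.hub_le s'
    have g12 := g10 false
    simp only [Bool.toNat_false, add_zero] at g12
    rw [g12] at g11
    have g13 : anc' k = s' := le_antisymm g11 (g8 k le_rfl g1)
    intro σ
    rw [g10, g13]
  have hσ : σ = true := by
    by_contra hc
    rw [Bool.not_eq_true] at hc
    subst hc
    exact h3 (by rw [h4, hw]; simpa using hslot false)
  subst hσ
  have hin : ∀ t, 1 ≤ t → t < n + 1 → (Q t).1.length = s' := by
    intro t g10 g11
    refine (hQ.ip.mono (x' := 1) (y' := n + 1) (by omega) le_rfl).propagate
      (fun v => v.1.length = s') ?_ le_rfl (by omega) (by rw [h4, hw]) g10 g11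
    intro p q q1 q2 q3 q4 q5 q6
    by_cases hq : q = 1
    · rw [hq, h4, hw]
    have q7 := (hQ.below q q3 (by omega)).1.length_le
    rcases q6 with q6 | (⟨q6, q8, q9⟩ | ⟨c, q6, q8 | q8⟩)
    · have := q6.length_le
      omega
    · rw [← q8]
      exact q5
    · exfalso
      have q9 := q8.length
      refine hQ.not_hub (i := q) (by omega) (by omega) (by simp [q6]) ?_
      have := hslot true
      rw [Bool.toNat_true] at this
      rw [← q9, q5, this, hw]
    · exfalso
      have q9 := q8.length
      rw [length_suf (h.hub_le _)] at q9
      exact g9 (Q q).1.length (by omega) (hQ.below q q3 (by omega)).2 (by omega)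
  have := (hQ.ip.mono (x' := 1) (y' := n + 1) (by omega) le_rfl).le_three (w := w)
    (fun t g10 g11 => ⟨(hQ.below t g10 (by omega)).1, by rw [hin t g10 g11, hw]; omega⟩)
  have := hM j le_rfl
  omega

end

section

variable {a : ℕ → ℕ × Bool} {κ : ℕ → ℕ} {L i s T : ℕ} {anc : ℕ → ℕ} {X : ℕ × Bool}
  {w : List Bool} {Q : ℤ → GVert} {x y : ℤ}

theorem isRank_succ (x : ℕ) (anc : ℕ → ℕ) : IsRank L (L + 1) x anc :=
  ⟨fun h => by omega, fun r h1 h2 => by omega⟩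

/-- The reversal of a path in a block starting at a bottom vertex. -/
theorem Block.free_bottom (h : Block a κ L i anc s) (hw : w.length = s) (hQ : IP a Q x y)
    (hxy : x < y) (hb : ∀ t, x ≤ t → t < y → Below w (s + blockLen κ i) (Q t))
    (hav : ∀ t, x ≤ t → t < y → ¬ Mark a X (Q t))
    (hy : (Q (y - 1)).1.length + 1 = s + blockLen κ i) (hT : ∀ k < i, TailBound a κ L k T) :
    y - x ≤ (2 * crossBound κ (L + 1) i + T : ℕ) := by
  have hle := h.le
  have := h.bottom_free (j := L + 1) (X := X) (by omega) (isRank_succ _ _) hw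
    (hQ.reflect (y - 1) (x' := 0) (y' := y - x) (by omega) (by omega)) (by omega)
    (fun t h1 h2 => hb _ (by omega) (by omega)) (fun t h1 h2 => hav _ (by omega) (by omega))
    (by simpa using hy) hT
  omega

/-- Paths in a block are short. -/
theorem Block.free_free (h : Block a κ L i anc s) (hw : w.length = s) (hQ : IP a Q x y)
    (hxy : x < y) (hb : ∀ t, x ≤ t → t < y → Below w (s + blockLen κ i) (Q t))
    (hav : ∀ t, x ≤ t → t < y → ¬ Mark a X (Q t)) (hT : ∀ k < i, TailBound a κ L k T) :
    y - x ≤ (2 * crossBound κ (L + 1) i + 2 * T : ℕ) := by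
  induction i generalizing anc s w x y with
  | zero =>
    have h1 := hQ.le_of_hub_le h.hub_le hb
      (fun d h1 h2 => hw ▸ h.seal_le (d := d) (by simp [coreLen]; omega) h2)
    have h2 : s + blockLen κ 0 - w.length = sealLen κ 0 := by simp [hw, blockLen]
    rw [h2] at h1
    have := h.rank_le 0 h.le
    have := le_crossBound_zero (κ := κ) (j := L + 1) (by omega)
    push_cast
    omega
  | succ i ih =>
    have hle := h.le
    have hrk := h.rank_le (i + 1) h.le
    rw [crossBound_succ (by omega)]
    have hlen := blockLen_eq (κ := κ) (i + 1)
    have hpos := four_le_sealLen (κ := κ) (i + 1)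
    rw [coreLen] at hlen
    have hu : s + blockLen κ (i + 1) - (s + 2 * blockLen κ i) = sealLen κ (i + 1) := by omega
    rcases h.cut_seal hw le_rfl hQ hxy hb with h1 | ⟨x', y', h1, h2, h3, h4, h5, h6⟩
    · push_cast
      omega
    rw [hu] at h5 h6
    have hQ' := hQ.mono h1 h3
    have hav' : ∀ t, x' ≤ t → t < y' → ¬ Mark a X (Q t) := fun t g1 g2 => hav t (by omega) (by omega)
    have hT' : ∀ k ≤ i, TailBound a κ L k T := fun k hk => hT k (by omega)
    rcases h5 with rfl | ⟨h5, h7, h8⟩ <;> rcases h6 with rfl | ⟨h6, h7', h8'⟩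
    · have hC : y' - x ≤ (2 * crossBound κ (L + 1) i + 2 * T : ℕ) := by
        rcases h.cut_core hw hQ' h2 h4 with ⟨w', g1, g2⟩ | ⟨x₁, y₁, g1, g2, g3, g4, g5, g6⟩
        · exact ih h.right g1 hQ' h2 g2 hav' (fun k hk => hT k (by omega))
        have hQ₁ := hQ'.mono g1 g3
        have hav₁ : ∀ t, x₁ ≤ t → t < y₁ → ¬ Mark a X (Q t) :=
          fun t g1 g2 => hav t (by omega) (by omega)
        have hT₁ : ∀ k < i, TailBound a κ L k T := fun k hk => hT k (by omega)
        rcases g5 with rfl | ⟨g5, g7, w₁, σ₁, g8, g9⟩ <;>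
          rcases g6 with rfl | ⟨g6, g7', w₂, σ₂, g8', g9'⟩
        · exact ih h.left hw hQ₁ g2 g4 hav₁ hT₁
        · have := (hT i (by omega)).right h g8' g9'
          have := h.left.free_bottom hw hQ₁ g2 g4 hav₁ g7' hT₁
          push_cast at this ⊢
          omega
        · have := (hT i (by omega)).right h g8 g9
          have := h.left.bottom_free (j := L + 1) (by omega) (isRank_succ _ _) hw hQ₁ g2 g4 hav₁ g7
            hT₁
          push_cast at this ⊢
          omega
        · have := (hT i (by omega)).right h g8 g9
          have := (hT i (by omega)).right h g8' g9'
          have := h.left.bottom_bottom (j := L + 1) (by omega) (isRank_succ _ _) hw hQ₁ g2 g4 hav₁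
            g7 g7'
          push_cast at this ⊢
          omega
      push_cast at hC ⊢
      omega
    · have := h.core_avoid_bottom_free (j := L + 1) (X := X) (by omega) (isRank_succ _ _) hw
        (hQ'.reflect (y' - 1) (x' := 0) (y' := y' - x) (by omega) (by omega)) (by omega)
        (fun t h1 h2 => h4 _ (by omega) (by omega)) (fun t h1 h2 => hav' _ (by omega) (by omega))
        (by simpa using h7') hT'
      push_cast at this ⊢
      omega
    · have := h.core_avoid_bottom_free (j := L + 1) (by omega) (isRank_succ _ _) hw hQ' h2 h4 hav'
        h7 hT'
      push_cast at this ⊢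
      omega
    · have := h.core_avoid_bottom_bottom (j := L + 1) (by omega) (isRank_succ _ _) hw hQ' h2 h4
        hav' h7 h7'
      push_cast at this ⊢
      omega

end

/-- The largest rank of an ancestor place used as a hub by the seals of rank `k`. -/
def reach (q k : ℕ) : ℕ := min (2 ^ q) (k + 2 * Nat.gcd k (2 ^ q))

theorem mul_card_dvd_le (d p n : ℕ) :
    d * ((Finset.Ioc p (p + n)).filter (d ∣ ·)).card ≤ n + d := by
  have h1 : ((Finset.Ioc p (p + n)).filter (d ∣ ·)).card +
      ((Finset.Ioc 0 p).filter (d ∣ ·)).card = ((Finset.Ioc 0 (p + n)).filter (d ∣ ·)).card := by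
    rw [← Finset.Ioc_union_Ioc_eq_Ioc (Nat.zero_le p) (Nat.le_add_right p n),
      Finset.filter_union, Finset.card_union_of_disjoint, add_comm]
    exact Finset.disjoint_filter_filter (Finset.Ioc_disjoint_Ioc_of_le le_rfl)
  rw [Nat.Ioc_filter_dvd_card_eq_div, Nat.Ioc_filter_dvd_card_eq_div] at h1
  rcases Nat.eq_zero_or_pos d with rfl | hd
  · simp
  have h2 := Nat.mul_div_le (p + n) d
  have h3 := Nat.lt_mul_div_succ p hd
  have h4 : d * ((Finset.Ioc p (p + n)).filter (d ∣ ·)).card + d * (p / d) = d * ((p + n) / d) := by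
    rw [← mul_add, h1]
  rw [mul_add] at h3
  omega

theorem sum_gcd_le (q p n M : ℕ) :
    ∑ k ∈ Finset.Ioc p (p + n), (if Nat.gcd k (2 ^ q) ≤ M then Nat.gcd k (2 ^ q) else 0) ≤
      (q + 1) * (n + M) := by
  calc ∑ k ∈ Finset.Ioc p (p + n), (if Nat.gcd k (2 ^ q) ≤ M then Nat.gcd k (2 ^ q) else 0)
      ≤ ∑ k ∈ Finset.Ioc p (p + n), ∑ e ∈ Finset.range (q + 1),
          (if 2 ^ e ∣ k ∧ 2 ^ e ≤ M then 2 ^ e else 0) := by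
        refine Finset.sum_le_sum fun k _ => ?_
        split_ifs with h
        · obtain ⟨e, he, he'⟩ := (Nat.dvd_prime_pow Nat.prime_two).1 (Nat.gcd_dvd_right k (2 ^ q))
          have h1 := Finset.single_le_sum
            (f := fun e => if 2 ^ e ∣ k ∧ 2 ^ e ≤ M then 2 ^ e else 0)
            (fun _ _ => Nat.zero_le _) (Finset.mem_range.2 (Nat.lt_succ_of_le he))
          have h2 : 2 ^ e ∣ k := he' ▸ Nat.gcd_dvd_left k (2 ^ q)
          rw [if_pos ⟨h2, he' ▸ h⟩] at h1
          exact he'.trans_le h1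
        · exact Nat.zero_le _
    _ = ∑ e ∈ Finset.range (q + 1), ∑ k ∈ Finset.Ioc p (p + n),
          (if 2 ^ e ∣ k ∧ 2 ^ e ≤ M then 2 ^ e else 0) := Finset.sum_comm
    _ ≤ ∑ e ∈ Finset.range (q + 1), (n + M) := by
        refine Finset.sum_le_sum fun e _ => ?_
        by_cases h : 2 ^ e ≤ M
        · have := mul_card_dvd_le (2 ^ e) p n
          simp only [h, and_true]
          rw [← Finset.sum_filter, Finset.sum_const, smul_eq_mul, mul_comm]
          omega
        · simp [h]
    _ = (q + 1) * (n + M) := by simp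

theorem crossBound_le_add_sum {κ : ℕ → ℕ} {j k i : ℕ} (h : k ≤ i) :
    crossBound κ j i ≤ crossBound κ j k +
      ∑ r ∈ Finset.Ioc k i, (if κ r < j then 12 * sealLen κ r + 26 else 0) := by
  induction i, h using Nat.le_induction with
  | base => simp
  | succ i h ih =>
    rw [← Finset.insert_Ioc_right_eq_Ioc_add_one h, Finset.sum_insert (by simp)]
    by_cases h1 : κ (i + 1) < j
    · rw [crossBound_succ h1, if_pos h1]
      omega
    · rw [crossBound_of_le (by omega)]
      have := le_crossBound (κ := κ) (i := i) (j := j)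
      omega

theorem gcd_two_pow_pos (q k : ℕ) : 0 < Nat.gcd k (2 ^ q) := Nat.gcd_pos_of_pos_right _ (by positivity)

theorem le_reach {q k : ℕ} (h : k ≤ 2 ^ q) : k ≤ reach q k ∧ reach q k ≤ 2 ^ q := by
  unfold reach
  omega

theorem sealLen_reach_le (q k : ℕ) : sealLen (reach q) k ≤ 8 * Nat.gcd k (2 ^ q) + 4 := by
  unfold sealLen reach
  omega

theorem sealLen_reach_le' (q k : ℕ) : sealLen (reach q) k ≤ 4 * (2 ^ q + 1) := by
  have : reach q k ≤ 2 ^ q := min_le_left _ _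
  unfold sealLen
  omega

theorem crossBound_reach_le {q i j : ℕ} (hij : i ≤ j) (hj : j ≤ 2 ^ q) :
    crossBound (reach q) j i ≤ 730 * (q + 1) * (j - i + 1) := by
  rcases hij.eq_or_lt with rfl | hij
  · rw [crossBound_of_le (le_reach hj).1]
    nlinarith
  obtain ⟨D, hD⟩ : ∃ D, j - i = D := ⟨_, rfl⟩
  obtain ⟨m, hm1, hm2⟩ : ∃ m, D ≤ 2 ^ m ∧ 2 ^ m < 2 * D := by
    rcases (show D = 1 ∨ 1 < D by omega) with h | h
    · exact ⟨0, by omega, by omega⟩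
    · refine ⟨Nat.clog 2 D, Nat.le_pow_clog one_lt_two D, ?_⟩
      have h1 := Nat.pow_pred_clog_lt_self one_lt_two h
      have h2 : Nat.clog 2 D = (Nat.clog 2 D).pred + 1 :=
        (Nat.succ_pred_eq_of_pos (Nat.clog_pos one_lt_two h)).symm
      rw [h2, pow_succ]
      omega
  have hmq : m ≤ q := by
    by_contra hc
    have := Nat.pow_le_pow_right (n := 2) two_pos (show q + 1 ≤ m by omega)
    rw [pow_succ] at this
    omega
  obtain ⟨p, hp⟩ : ∃ p, 2 ^ m * (i / 2 ^ m) = p := ⟨_, rfl⟩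
  have hpi : p ≤ i := hp ▸ Nat.mul_div_le i (2 ^ m)
  have hip : i < p + 2 ^ m := by
    rw [← hp, ← mul_add_one]
    exact Nat.lt_mul_div_succ i (by positivity)
  have hg : 2 ^ m ≤ Nat.gcd p (2 ^ q) :=
    Nat.le_of_dvd (gcd_two_pow_pos q p)
      (Nat.dvd_gcd (hp ▸ Nat.dvd_mul_right _ _) (pow_dvd_pow 2 hmq))
  have hseal : j ≤ reach q p := by
    unfold reach
    omega
  have h1 := crossBound_le_add_sum (κ := reach q) (j := j) hpi
  rw [crossBound_of_le hseal] at h1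
  have h2 : ∑ r ∈ Finset.Ioc p i, (if reach q r < j then 12 * sealLen (reach q) r + 26 else 0) ≤
      ∑ r ∈ Finset.Ioc p (p + (i - p)),
        170 * (if Nat.gcd r (2 ^ q) ≤ 2 * D then Nat.gcd r (2 ^ q) else 0) := by
    rw [Nat.add_sub_cancel' hpi]
    refine Finset.sum_le_sum fun r hr => ?_
    rw [Finset.mem_Ioc] at hr
    have h3 := sealLen_reach_le q r
    have h4 := gcd_two_pow_pos q r
    split_ifs with h5 h6
    · omega
    · unfold reach at h5
      omega
    · omega
    · omega
  rw [← Finset.mul_sum] at h2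
  have h3 := sum_gcd_le q p (i - p) (2 * D)
  have h4 : (q + 1) * (i - p + 2 * D) ≤ (q + 1) * (4 * D) := Nat.mul_le_mul_left _ (by omega)
  have h5 : crossBound (reach q) j i ≤ 36 * D + 14 + 170 * ((q + 1) * (4 * D)) := by omega
  rw [hD]
  nlinarith

theorem crossBound_reach_top_le (q : ℕ) :
    crossBound (reach q) (2 ^ q + 1) (2 ^ q) ≤ 430 * (q + 1) * 2 ^ q := by
  have h1 := crossBound_le_add_sum (κ := reach q) (j := 2 ^ q + 1) (Nat.zero_le (2 ^ q))
  have h2 : ∑ r ∈ Finset.Ioc 0 (2 ^ q),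
      (if reach q r < 2 ^ q + 1 then 12 * sealLen (reach q) r + 26 else 0) ≤
      ∑ r ∈ Finset.Ioc 0 (0 + 2 ^ q),
        170 * (if Nat.gcd r (2 ^ q) ≤ 2 ^ q then Nat.gcd r (2 ^ q) else 0) := by
    rw [zero_add]
    refine Finset.sum_le_sum fun r hr => ?_
    have h3 := sealLen_reach_le q r
    have h4 := gcd_two_pow_pos q r
    rw [if_pos (Nat.gcd_le_right _ (by positivity))]
    split_ifs <;> omega
  rw [← Finset.mul_sum] at h2
  have h3 := sum_gcd_le q 0 (2 ^ q) (2 ^ q)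
  have h4 : crossBound (reach q) (2 ^ q + 1) 0 ≤ 36 * 2 ^ q + 50 := by
    have := sealLen_reach_le' q 0
    rw [crossBound]
    split <;> omega
  have h5 : crossBound (reach q) (2 ^ q + 1) (2 ^ q) ≤
    36 * 2 ^ q + 50 + 170 * ((q + 1) * (2 ^ q + 2 ^ q)) := by omega
  have h6 := Nat.one_le_two_pow (n := q)
  nlinarith

/-- The bound for tails in blocks of rank `k`. -/
def tailMax (q k : ℕ) : ℕ := 24 * (2 ^ q + 1) + 1 + 20000 * (q + 1) * k

theorem tailMax_mono (q : ℕ) : Monotone (tailMax q) := fun k l h => by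
  unfold tailMax
  gcongr

theorem tailBound_reach {a : ℕ → ℕ × Bool} {q j : ℕ} (hj : j ≤ 2 ^ q) :
    TailBound a (reach q) (2 ^ q) j (tailMax q j) := by
  induction j using Nat.strong_induction_on with
  | _ j ih =>
    refine tailBound_of_lt hj (tailMax_mono q) (fun k hk => ih k hk (by omega)) (fun k hk => ?_)
      (fun k hk => ?_)
    · have := sealLen_reach_le' q k
      unfold tailMax
      omega
    · have h1 := crossBound_reach_le (q := q) (show k + 1 ≤ j from hk) hj
      have h2 := crossBound_reach_le (q := q) hk.le hj
      obtain ⟨D, rfl⟩ := Nat.exists_eq_add_of_lt hk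
      rw [show k + D + 1 - (k + 1) + 1 = D + 1 by omega] at h1
      rw [show k + D + 1 - k + 1 = D + 2 by omega] at h2
      unfold tailMax
      nlinarith

theorem Block.length_le {a : ℕ → ℕ × Bool} {q : ℕ} {anc : ℕ → ℕ}
    (h : Block a (reach q) (2 ^ q) (2 ^ q) anc 0) {Q : ℤ → GVert} {n : ℕ} (hQ : IP a Q 0 n)
    (hb : ∀ t, 0 ≤ t → t < (n : ℤ) → (Q t).1.length < blockLen (reach q) (2 ^ q)) :
    n ≤ 41000 * (q + 1) * 2 ^ q := by
  rcases Nat.eq_zero_or_pos n with rfl | hn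
  · simp
  have h1 := h.free_free (X := (blockLen (reach q) (2 ^ q), false)) (w := []) rfl hQ (by omega)
    (fun t h1 h2 => ⟨List.nil_suffix, by simpa using hb t h1 h2⟩)
    (fun t h1 h2 h3 => by
      have h4 := h.hub_le (Q t).1.length
      have h5 := hb t h1 h2
      rw [h3.2] at h4
      simp only at h4
      omega)
    (fun k hk => fun anc s g1 g2 w σ Q n g3 g4 => (tailBound_reach hk.le anc s g1 g2 w σ Q n g3 g4).trans
      (Nat.cast_le.2 (tailMax_mono q hk.le)))
  have h2 := crossBound_reach_top_le q
  have h3 : n ≤ 2 * crossBound (reach q) (2 ^ q + 1) (2 ^ q) + 2 * tailMax q (2 ^ q) := by omega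
  unfold tailMax at h3
  have h6 := Nat.one_le_two_pow (n := q)
  nlinarith

/-- The hubs of a block of rank `k`. -/
def blockHub (κ : ℕ → ℕ) : ℕ → (ℕ → ℕ) → ℕ → ℕ → ℕ × Bool
  | 0, anc, s, d => sealHub κ 0 (Function.update anc 0 s) (d - s)
  | k + 1, anc, s, d =>
      if d < s + blockLen κ k then blockHub κ k (Function.update anc (k + 1) s) s d
      else if d < s + 2 * blockLen κ k then
        blockHub κ k (Function.update anc (k + 1) s) (s + blockLen κ k) d
      else sealHub κ (k + 1) (Function.update anc (k + 1) s) (d - (s + 2 * blockLen κ k))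

theorem blockHub_le {κ : ℕ → ℕ} {k s d : ℕ} {anc : ℕ → ℕ} (hanc : ∀ r, anc r ≤ s) (hd : s ≤ d) :
    (blockHub κ k anc s d).1 ≤ d := by
  have hup : ∀ r l, Function.update anc l s r ≤ s := fun r l => by
    rcases eq_or_ne r l with rfl | h
    · simp
    · rw [Function.update_of_ne h]
      exact hanc r
  induction k generalizing anc s with
  | zero => exact (hup _ _).trans hd
  | succ k ih =>
    rw [blockHub]
    split_ifs with h1 h2
    · refine ih (fun r => hup r _) hd (fun r l => ?_)
      rw [Function.update_apply]
      split_ifs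
      · exact le_rfl
      · exact hup _ _
    · refine ih (fun r => (hup r _).trans (Nat.le_add_right _ _)) (by omega) (fun r l => ?_)
      rw [Function.update_apply]
      split_ifs
      · exact le_rfl
      · exact (hup _ _).trans (Nat.le_add_right _ _)
    · exact (hup _ _).trans hd

theorem isBlock_of_eq_blockHub {a : ℕ → ℕ × Bool} {κ : ℕ → ℕ} {k s : ℕ} {anc : ℕ → ℕ}
    (h : ∀ d, s ≤ d → d < s + blockLen κ k → a d = blockHub κ k anc s d) : IsBlock a κ k anc s := by
  induction k generalizing anc s with
  | zero =>
    intro off ho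
    rw [h _ (by omega) (by rw [blockLen]; omega), blockHub, Nat.add_sub_cancel_left]
  | succ k ih =>
    have hlen : blockLen κ (k + 1) = 2 * blockLen κ k + sealLen κ (k + 1) := rfl
    refine ⟨ih fun d h1 h2 => ?_, ih fun d h1 h2 => ?_, fun off ho => ?_⟩
    · rw [h d h1 (by omega), blockHub, if_pos h2]
    · rw [h d (by omega) (by omega), blockHub, if_neg (by omega), if_pos (by omega)]
    · rw [h _ (by omega) (by omega), blockHub, if_neg (by omega), if_neg (by omega),
        Nat.add_sub_cancel_left]

theorem exists_block (q : ℕ) : ∃ a anc, Block a (reach q) (2 ^ q) (2 ^ q) anc 0 :=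
  ⟨blockHub (reach q) (2 ^ q) (fun _ => 0) 0, fun _ => 0, fun d => blockHub_le (by simp) (by simp),
    fun _ h => le_reach h, le_rfl, by simp, isBlock_of_eq_blockHub fun _ _ _ => rfl⟩

theorem two_pow_lt_blockLen (κ : ℕ → ℕ) (k : ℕ) : 2 ^ k < blockLen κ k := by
  induction k with
  | zero =>
    have := four_le_sealLen (κ := κ) 0
    rw [blockLen]
    omega
  | succ k ih =>
    rw [blockLen, pow_succ]
    omega

theorem Up.ne {a : ℕ → ℕ × Bool} (ha : ∀ d, (a d).1 ≤ d) {v u : GVert} (h : Up a v u) : v ≠ u := by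
  rintro rfl
  rcases h with ⟨h1, -, h2⟩ | ⟨c, -, h | h⟩
  · exact h2 h1
  · have := h.length
    omega
  · have := h.length
    rw [length_suf (ha _)] at this
    have := ha v.1.length
    omega

theorem Up.rank_lt {a : ℕ → ℕ × Bool} {v u : GVert} (h : Up a v u) :
    2 * u.1.length + (if u.2 = none then 1 else 0) <
      2 * v.1.length + (if v.2 = none then 1 else 0) := by
  rcases h with ⟨h1, h2, h3⟩ | ⟨c, -, h | h⟩
  · rw [if_neg h3, if_pos h1, h2]
    omega
  · have := h.length
    split_ifs <;> omega
  · have := h.length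
    have := (suf_suffix (a v.1.length).1 v.1).length_le
    split_ifs <;> omega

theorem isEnd_subset (σ : Bool) (w : List Bool) : ∃ p, ∀ u, IsEnd σ w u → u = p := by
  cases w with
  | nil => exact ⟨([], none), fun u h => h.elim⟩
  | cons b t => exact ⟨_, fun u h => h⟩

theorem up_subset (a : ℕ → ℕ × Bool) (v : GVert) : ∃ p p', ∀ u, Up a v u → u = p ∨ u = p' := by
  rcases v with ⟨w, _ | c⟩
  · refine ⟨(w, some false), (w, some true), ?_⟩
    rintro ⟨w', _ | _ | _⟩ (⟨-, h1, h2⟩ | ⟨c, h, -⟩) <;> simp_all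
  · obtain ⟨p, hp⟩ := isEnd_subset c w
    obtain ⟨p', hp'⟩ := isEnd_subset (a w.length).2 (suf (a w.length).1 w)
    refine ⟨p, p', ?_⟩
    rintro u (⟨h, -⟩ | ⟨c', h, h' | h'⟩)
    · simp at h
    · simp only [Option.some.injEq] at h
      subst h
      exact Or.inl (hp u h')
    · exact Or.inr (hp' u h')

/-- The graph on the vertices of depth less than `D` given by the hubs `a`. -/
def hubGraph (a : ℕ → ℕ × Bool) (D : ℕ) : SimpleGraph {v : GVert // v.1.length < D} :=
  SimpleGraph.fromRel fun v u => Up a v.1 u.1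

theorem hubGraph_adj {a : ℕ → ℕ × Bool} (ha : ∀ d, (a d).1 ≤ d) {D : ℕ}
    {u v : {v : GVert // v.1.length < D}} :
    (hubGraph a D).Adj u v ↔ Up a u.1 v.1 ∨ Up a v.1 u.1 := by
  rw [hubGraph, SimpleGraph.fromRel_adj]
  refine ⟨And.right, fun h => ⟨?_, h⟩⟩
  rintro rfl
  rcases h with h | h <;> exact h.ne ha rfl

instance finite_vertices (D : ℕ) : Finite {v : GVert // v.1.length < D} :=
  Set.Finite.to_subtype (s := {v : GVert | v.1.length < D})
    (Set.Finite.subset ((List.finite_length_lt Bool D).prod (Set.finite_univ (α := Option Bool)))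
      fun _ hv => ⟨hv, Set.mem_univ _⟩)

theorem degenerate_hubGraph {a : ℕ → ℕ × Bool} (ha : ∀ d, (a d).1 ≤ d) (D : ℕ) {k : ℕ} (hk : 2 ≤ k) :
    Degenerate k (hubGraph a D) := by
  intro S hS hne
  obtain ⟨v, hv, hmax⟩ := Set.exists_max_image S
    (fun v => 2 * v.1.1.length + (if v.1.2 = none then 1 else 0)) hS hne
  refine ⟨v, hv, ?_⟩
  obtain ⟨p, p', hp⟩ := up_subset a v.1
  refine le_trans (Set.ncard_le_ncard_of_injOn (t := {p, p'}) Subtype.val ?_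
    Subtype.val_injective.injOn (Set.toFinite _)) ((Set.ncard_insert_le _ _).trans ?_)
  · rintro u ⟨hu, hvu⟩
    rcases (hubGraph_adj ha).1 hvu with h | h
    · exact hp _ h
    · exact absurd h.rank_lt (hmax u hu).not_gt
  · rw [Set.ncard_singleton]
    exact hk

/-- A path through the gadgets of the first `m` levels below `w`. -/
def gadgetPath : ℕ → List Bool → List GVert
  | 0, _ => []
  | m + 1, w => (w, some false) :: (gadgetPath m (false :: w) ++
      (w, none) :: ((gadgetPath m (true :: w)).reverse ++ [(w, some true)]))

theorem isChain_gadgetPath (a : ℕ → ℕ × Bool) (m : ℕ) {w : List Bool} {x y : GVert}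
    (hx : IsEnd false w x) (hy : IsEnd true w y) :
    (x :: (gadgetPath m w ++ [y])).IsChain (fun u v => Up a u v ∨ Up a v u) := by
  induction m generalizing w x y with
  | zero => simpa [gadgetPath] using hx.adj hy (by simp)
  | succ m ih =>
    have h1 := ih (w := false :: w) (x := (w, some false)) (y := (w, none)) rfl rfl
    have h2 := ih (w := true :: w) (x := (w, some true)) (y := (w, none)) rfl rfl
    have h3 : ((w, none) :: ((gadgetPath m (true :: w)).reverse ++ [(w, some true)])).IsChain
        (fun u v => Up a u v ∨ Up a v u) := by
      rw [← List.isChain_reverse]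
      simp only [List.reverse_cons, List.reverse_append, List.reverse_reverse]
      simpa [or_comm] using h2
    rw [gadgetPath]
    simp only [List.cons_append, List.append_assoc, List.nil_append]
    refine List.IsChain.cons_cons (Or.inr (Or.inr ⟨_, rfl, Or.inl hx⟩)) ?_
    rw [List.isChain_cons_split]
    refine ⟨h1, ?_⟩
    rw [List.isChain_cons_append_cons_cons]
    exact ⟨h3, Or.inl (Or.inr ⟨_, rfl, Or.inl hy⟩), by simp⟩

theorem mem_gadgetPath {m : ℕ} {w : List Bool} {v : GVert} (h : v ∈ gadgetPath m w) :
    w <:+ v.1 ∧ v.1.length < w.length + m := by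
  induction m generalizing w with
  | zero => simp [gadgetPath] at h
  | succ m ih =>
    simp only [gadgetPath, List.mem_cons, List.mem_append, List.mem_reverse, List.not_mem_nil,
      or_false] at h
    rcases h with rfl | h | rfl | h | rfl
    · simp
    · have := ih h
      exact ⟨(List.suffix_cons _ _).trans this.1, by simpa [add_assoc, add_comm 1] using this.2⟩
    · simp
    · have := ih h
      exact ⟨(List.suffix_cons _ _).trans this.1, by simpa [add_assoc, add_comm 1] using this.2⟩
    · simp

theorem nodup_gadgetPath (m : ℕ) (w : List Bool) : (gadgetPath m w).Nodup := by
  induction m generalizing w with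
  | zero => simp [gadgetPath]
  | succ m ih =>
    have h1 : ∀ b c, (w, c) ∉ gadgetPath m (b :: w) := fun b c h => by
      have := (mem_gadgetPath h).1.length_le
      simp at this
    have h2 : ∀ v ∈ gadgetPath m (false :: w), v ∉ gadgetPath m (true :: w) := fun v h h' => by
      have := suf_eq_of_suffix (mem_gadgetPath h).1
      have h3 := suf_eq_of_suffix (mem_gadgetPath h').1
      simp only [List.length_cons] at this h3
      simp [this] at h3
    have h3 := ih (false :: w)
    have h4 := ih (true :: w)
    rw [gadgetPath]
    simp only [List.nodup_cons, List.nodup_append, List.mem_append, List.mem_cons, List.mem_reverse,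
      List.nodup_reverse]
    grind

theorem two_pow_le_length_gadgetPath (m : ℕ) (w : List Bool) :
    2 ^ (m + 1) ≤ (gadgetPath (m + 1) w).length := by
  induction m generalizing w with
  | zero => simp [gadgetPath]
  | succ m ih =>
    have h1 := ih (false :: w)
    have h2 := ih (true :: w)
    rw [gadgetPath, pow_succ]
    simp only [List.length_cons, List.length_append, List.length_reverse]
    omega

theorem hasPathOn_hubGraph {a : ℕ → ℕ × Bool} (ha : ∀ d, (a d).1 ≤ d) {D m : ℕ} (hm : m + 1 < D) :
    HasPathOn (hubGraph a D) (2 ^ (m + 1)) := by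
  have hlen := two_pow_le_length_gadgetPath m [false]
  have hnd := nodup_gadgetPath (m + 1) [false]
  have hch := (isChain_gadgetPath a (m + 1) (w := [false]) (x := ([], some false))
    (y := ([], none)) rfl rfl).infix (l₁ := gadgetPath (m + 1) [false])
    ⟨[([], some false)], [([], none)], by simp⟩
  rw [List.isChain_iff_getElem] at hch
  refine ⟨fun i => ⟨(gadgetPath (m + 1) [false])[i.1]'(i.2.trans_le hlen), ?_⟩, fun i j h => ?_,
    fun i h => (hubGraph_adj ha).2 (hch i (h.trans_le hlen))⟩
  · have := (mem_gadgetPath (List.getElem_mem (i.2.trans_le hlen))).2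
    simp only [List.length_cons, List.length_nil] at this
    omega
  · simp only [Subtype.mk.injEq] at h
    exact Fin.ext (hnd.getElem_inj_iff.1 h)

theorem length_le_of_hasInducedPathOn {q : ℕ} {a : ℕ → ℕ × Bool} {anc : ℕ → ℕ}
    (h : Block a (reach q) (2 ^ q) (2 ^ q) anc 0) {n : ℕ}
    (hp : HasInducedPathOn (hubGraph a (blockLen (reach q) (2 ^ q))) n) :
    n ≤ 41000 * (q + 1) * 2 ^ q := by
  obtain ⟨p, hinj, hadj⟩ := hp
  refine h.length_le (Q := fun t => if ht : t.toNat < n then (p ⟨t.toNat, ht⟩).1 else ([], none))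
    (fun i j h1 h2 h3 h4 => ?_) (fun t h1 h2 => ?_)
  · simp only
    rw [dif_pos (by omega), dif_pos (by omega), ← hubGraph_adj h.hub_le, hadj, Subtype.val_inj,
      hinj.eq_iff, Fin.mk.injEq]
    dsimp only
    omega
  · rw [dif_pos (by omega)]
    exact (p _).2

theorem degenerate_lower_bound_upper_limit (k : ℕ) (hk : 2 ≤ k) :
    ∃ c : ℝ, 0 < c ∧
      ∀ f : ℕ → ℕ,
        (∀ (V : Type) [Fintype V] (G : SimpleGraph V) (n : ℕ),
            Degenerate k G → HasPathOn G n → ∃ m : ℕ, f n ≤ m ∧ HasInducedPathOn G m) →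
        ∀ N : ℕ, ∃ n : ℕ, N ≤ n ∧
          (f n : ℝ) ≤ c * Real.logb 2 (Real.logb 2 n) *
            Real.logb 2 (Real.logb 2 (Real.logb 2 n)) := by
  refine ⟨82000, by norm_num, fun f hf N => ?_⟩
  obtain ⟨q, hNq, hq⟩ : ∃ q, N ≤ q ∧ 1 ≤ q := ⟨N + 1, by omega, by omega⟩
  obtain ⟨a, anc, h⟩ := exists_block q
  have h1 : q < 2 ^ q := Nat.lt_two_pow_self
  have h2 : 2 ^ q < 2 ^ 2 ^ q := Nat.lt_two_pow_self
  have h3 : 2 ^ 2 ^ q < 2 ^ 2 ^ 2 ^ q := Nat.lt_two_pow_self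
  have := Fintype.ofFinite {v : GVert // v.1.length < blockLen (reach q) (2 ^ q)}
  have hpath : HasPathOn (hubGraph a (blockLen (reach q) (2 ^ q))) (2 ^ 2 ^ 2 ^ q) := by
    have h4 := two_pow_lt_blockLen (reach q) (2 ^ q)
    obtain ⟨m, hm⟩ := Nat.exists_eq_add_of_lt (Nat.zero_lt_of_lt h2)
    rw [zero_add] at hm
    rw [hm] at h4 ⊢
    exact hasPathOn_hubGraph h.hub_le h4
  obtain ⟨m, hfm, hm⟩ := hf _ _ _ (degenerate_hubGraph h.hub_le _ hk) hpath
  have h4 : f (2 ^ 2 ^ 2 ^ q) ≤ 82000 * 2 ^ q * q := by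
    calc f (2 ^ 2 ^ 2 ^ q) ≤ 41000 * (q + 1) * 2 ^ q :=
          hfm.trans (length_le_of_hasInducedPathOn h hm)
      _ ≤ 41000 * (2 * q) * 2 ^ q := by gcongr; omega
      _ = 82000 * 2 ^ q * q := by ring
  have hlog : ∀ e : ℕ, Real.logb 2 ((2 : ℝ) ^ e) = e := fun e => by
    rw [← Real.rpow_natCast, Real.logb_rpow (by norm_num) (by norm_num)]
  refine ⟨2 ^ 2 ^ 2 ^ q, by omega, ?_⟩
  have h5 : Real.logb 2 ((2 ^ 2 ^ 2 ^ q : ℕ) : ℝ) = (2 : ℝ) ^ 2 ^ q := by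
    rw [Nat.cast_pow, Nat.cast_ofNat, hlog, Nat.cast_pow, Nat.cast_ofNat]
  have h6 : Real.logb 2 ((2 : ℝ) ^ 2 ^ q) = (2 : ℝ) ^ q := by
    rw [hlog, Nat.cast_pow, Nat.cast_ofNat]
  rw [h5, h6, hlog]
  exact_mod_cast h4
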